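/- For every Artin-Tits presentation of sufficiently large type and every word w over S ∪ S⁻¹: w →_{0,1,2} ε (the empty word) if and only if w̄ = 1 in A(Γ₀). -/

import Mathlib

namespace ArtinTits

open Classical List

variable {S : Type*}

/-- A word over `S ∪ S⁻¹`: a list of letters, each a generator together with a sign
(`true` = the generator itself, `false` = its formal inverse). -/
abbrev Word (S : Type*) := List (S × Bool)

/-- The formal inverse of a word. -/
def wordInv (w : Word S) : Word S := w.reverse.map fun l => (l.1, !l.2)

/-- `[x,y,j⟩`: the alternating positive word `xyxy⋯` with `j` letters, beginning with `x`. -/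
def altWord (x y : S) : ℕ → Word S
  | 0 => []
  | j + 1 => (x, true) :: altWord y x j

/-- `⟨x,y,j]`: the alternating positive word `⋯xy` with `j` letters, ending with `y`. -/
def altWordR (x y : S) (j : ℕ) : Word S := (altWord y x j).reverse

/-- The data of a labelled finite complete simplicial graph `Γ₀`: a symmetric label map
with values in `{2,3,…} ∪ {∞}` on pairs of distinct vertices. -/
structure ArtinData (S : Type*) where
  m : S → S → ℕ∞
  symm : ∀ s t, m s t = m t s
  two_le : ∀ s t : S, s ≠ t → 2 ≤ m s t

/-- `u = v` is a defining (braid) relation of the Artin–Tits presentation. -/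
def IsRel (A : ArtinData S) (u v : Word S) : Prop :=
  ∃ (s t : S) (k : ℕ), s ≠ t ∧ A.m s t = (k : ℕ∞) ∧
    u = altWord s t k ∧ v = altWord t s k

/-- The relator set of the Artin–Tits presentation, inside the free group. -/
def rels (A : ArtinData S) : Set (FreeGroup S) :=
  {x | ∃ u v : Word S, IsRel A u v ∧ x = FreeGroup.mk u * (FreeGroup.mk v)⁻¹}

/-- The Artin–Tits group `A(Γ₀)` of the presentation. -/
abbrev ArtinGroup (A : ArtinData S) := PresentedGroup (rels A)

/-- `w̄`: the element of the Artin–Tits group represented by the word `w`. -/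
def wbar (A : ArtinData S) (w : Word S) : ArtinGroup A :=
  PresentedGroup.mk (rels A) (FreeGroup.mk w)

/-! ### Special transformations -/

/-- Type 0: delete a factor `s s⁻¹` or `s⁻¹ s`. -/
def Step0 (w w' : Word S) : Prop :=
  ∃ (w₁ w₂ : Word S) (s : S) (b : Bool),
    w = w₁ ++ [(s, b), (s, !b)] ++ w₂ ∧ w' = w₁ ++ w₂

/-- Type ∞: insert a factor `s s⁻¹` or `s⁻¹ s` (the inverse of type 0). -/
def StepInfty (w w' : Word S) : Prop := Step0 w' w

/-- Type 1: replace a factor `v` by `u`, or `v⁻¹` by `u⁻¹`, where `u = v` is a defining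
relation. -/
def Step1 (A : ArtinData S) (w w' : Word S) : Prop :=
  ∃ (w₁ w₂ u v : Word S), IsRel A u v ∧
    ((w = w₁ ++ v ++ w₂ ∧ w' = w₁ ++ u ++ w₂) ∨
     (w = w₁ ++ wordInv v ++ w₂ ∧ w' = w₁ ++ wordInv u ++ w₂))

/-- Type 2r: for a defining relation `u₁u₂ = v₁v₂` with `u₁, v₁` non-empty, replace a factor
`v₁⁻¹ u₁` by `v₂ u₂⁻¹`. -/
def Step2r (A : ArtinData S) (w w' : Word S) : Prop :=
  ∃ (w₁ w₂ u₁ u₂ v₁ v₂ : Word S), IsRel A (u₁ ++ u₂) (v₁ ++ v₂) ∧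
    u₁ ≠ [] ∧ v₁ ≠ [] ∧
    w = w₁ ++ wordInv v₁ ++ u₁ ++ w₂ ∧ w' = w₁ ++ v₂ ++ wordInv u₂ ++ w₂

/-- Type 2l: for a defining relation `u₁u₂ = v₁v₂` with `u₂, v₂` non-empty, replace a factor
`v₂ u₂⁻¹` by `v₁⁻¹ u₁`. -/
def Step2l (A : ArtinData S) (w w' : Word S) : Prop :=
  ∃ (w₁ w₂ u₁ u₂ v₁ v₂ : Word S), IsRel A (u₁ ++ u₂) (v₁ ++ v₂) ∧
    u₂ ≠ [] ∧ v₂ ≠ [] ∧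
    w = w₁ ++ v₂ ++ wordInv u₂ ++ w₂ ∧ w' = w₁ ++ wordInv v₁ ++ u₁ ++ w₂

/-- Type 2: a type 2r or type 2l transformation. -/
def Step2 (A : ArtinData S) (w w' : Word S) : Prop := Step2r A w w' ∨ Step2l A w w'

/-- `p` is the greatest (longest) common left factor of `x` and `y`. -/
def IsLCPrefix (p x y : Word S) : Prop :=
  p <+: x ∧ p <+: y ∧ ∀ q : Word S, q <+: x → q <+: y → q.length ≤ p.length

/-- `p` is the greatest (longest) common right factor of `x` and `y`. -/
def IsLCSuffix (p x y : Word S) : Prop :=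
  p <:+ x ∧ p <:+ y ∧ ∀ q : Word S, q <:+ x → q <:+ y → q.length ≤ p.length

/-- Type 2r⋆ : a type 2r transformation `w₁ v⁻¹ v' w₂ → w₁ u (u')⁻¹ w₂` (with `vu = v'u'` a
defining relation) such that `v` is the greatest common left factor of `vu` and `v w₁⁻¹`, and
`v'` is the greatest common left factor of `v'u'` and `v' w₂`. -/
def Step2rStar (A : ArtinData S) (w w' : Word S) : Prop :=
  ∃ (w₁ w₂ v u v' u' : Word S), IsRel A (v ++ u) (v' ++ u') ∧
    v ≠ [] ∧ v' ≠ [] ∧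
    w = w₁ ++ wordInv v ++ v' ++ w₂ ∧
    w' = w₁ ++ u ++ wordInv u' ++ w₂ ∧
    IsLCPrefix v (v ++ u) (v ++ wordInv w₁) ∧
    IsLCPrefix v' (v' ++ u') (v' ++ w₂)

/-- Type 2l⋆ : a type 2l transformation `w₁ v (v')⁻¹ w₂ → w₁ u⁻¹ u' w₂` (with `uv = u'v'` a
defining relation) such that `v` is the greatest common right factor of `uv` and `w₁ v`, and
`v'` is the greatest common right factor of `u'v'` and `w₂⁻¹ v'`. -/
def Step2lStar (A : ArtinData S) (w w' : Word S) : Prop :=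
  ∃ (w₁ w₂ v u v' u' : Word S), IsRel A (u ++ v) (u' ++ v') ∧
    v ≠ [] ∧ v' ≠ [] ∧
    w = w₁ ++ v ++ wordInv v' ++ w₂ ∧
    w' = w₁ ++ wordInv u ++ u' ++ w₂ ∧
    IsLCSuffix v (u ++ v) (w₁ ++ v) ∧
    IsLCSuffix v' (u' ++ v') (wordInv w₂ ++ v')

/-- Type 2⋆ : a type 2r⋆ or type 2l⋆ transformation. -/
def Step2Star (A : ArtinData S) (w w' : Word S) : Prop :=
  Step2rStar A w w' ∨ Step2lStar A w w'

/-- `w →_{0,1,2} w'`. -/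
def Steps012 (A : ArtinData S) : Word S → Word S → Prop :=
  Relation.ReflTransGen fun x y => Step0 x y ∨ Step1 A x y ∨ Step2 A x y

/-- `w →_{0,1,2⋆} w'`. -/
def Steps012Star (A : ArtinData S) : Word S → Word S → Prop :=
  Relation.ReflTransGen fun x y => Step0 x y ∨ Step1 A x y ∨ Step2Star A x y

/-- `w →_{2⋆} w'`. -/
def Steps2Star (A : ArtinData S) : Word S → Word S → Prop :=
  Relation.ReflTransGen (Step2Star A)

/-- `w →_{1,2⋆} w'`. -/
def Steps12Star (A : ArtinData S) : Word S → Word S → Prop :=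
  Relation.ReflTransGen fun x y => Step1 A x y ∨ Step2Star A x y

/-- `w →_{1,2} w'`. -/
def Steps12 (A : ArtinData S) : Word S → Word S → Prop :=
  Relation.ReflTransGen fun x y => Step1 A x y ∨ Step2 A x y

/-! ### Classes of words -/

/-- A positive word: written over `S`. -/
def Positive (w : Word S) : Prop := ∀ l ∈ w, l.2 = true

/-- A negative word: written over `S⁻¹`. -/
def Negative (w : Word S) : Prop := ∀ l ∈ w, l.2 = false

/-- A signed word: positive or negative. -/
def Signed (w : Word S) : Prop := Positive w ∨ Negative w

/-- An unsigned word: neither positive nor negative. -/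
def Unsigned (w : Word S) : Prop := ¬ Positive w ∧ ¬ Negative w

/-- A freely reduced word: no factor `s s⁻¹` or `s⁻¹ s`. -/
def FreelyReduced (w : Word S) : Prop :=
  ∀ (w₁ w₂ : Word S) (s : S) (b : Bool), w ≠ w₁ ++ [(s, b), (s, !b)] ++ w₂

/-- A square-free word: no factor `aa`. -/
def SquareFree (w : Word S) : Prop := ∀ a : S × Bool, ¬ [a, a] <:+: w

/-- `p̃(w)`: the length of the longest square-free positive factor of `w`. -/
noncomputable def ptilde (w : Word S) : ℕ :=
  sSup {n | ∃ v : Word S, v <:+: w ∧ Positive v ∧ SquareFree v ∧ v.length = n}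

/-- `ñ(w)`: the length of the longest negative factor of `w` whose formal inverse is
square-free. -/
noncomputable def ntilde (w : Word S) : ℕ :=
  sSup {n | ∃ v : Word S, v <:+: w ∧ Negative v ∧ SquareFree (wordInv v) ∧ v.length = n}

/-- `p(w) = min(p̃(w), m)`. -/
noncomputable def pfun (M : ℕ) (w : Word S) : ℕ := min (ptilde w) M

/-- `n(w) = min(ñ(w), m)`. -/
noncomputable def nfun (M : ℕ) (w : Word S) : ℕ := min (ntilde w) M

/-- `Ω(Γ₀)` (for a dihedral presentation with label `M`): the freely reduced words with
`max(p(w), n(w)) < M`. -/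
def Omega (M : ℕ) (w : Word S) : Prop :=
  FreelyReduced w ∧ max (pfun M w) (nfun M w) < M

/-- A signed square-free word (square-free positive, or negative with square-free inverse). -/
def SignedSF (w : Word S) : Prop :=
  (Positive w ∧ SquareFree w) ∨ (Negative w ∧ SquareFree (wordInv w))

/-- `v` is the maximal square-free signed left factor of `w`. -/
def MaxSignedSFPrefix (v w : Word S) : Prop :=
  v <+: w ∧ SignedSF v ∧ ∀ v' : Word S, v' <+: w → SignedSF v' → v'.length ≤ v.length

/-- `(v₁, …, v_k)` is the `⋆`-decomposition of `w`: the `v_i` are non-empty, `w = v₁⋯v_k`,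
and each `v_i` is the maximal square-free signed left factor of `v_i⋯v_k`. -/
def StarDecomp (w : Word S) (L : List (Word S)) : Prop :=
  w = L.flatten ∧ (∀ v ∈ L, v ≠ ([] : Word S)) ∧
    ∀ i (h : i < L.length), MaxSignedSFPrefix (L.get ⟨i, h⟩) ((L.drop i).flatten)

/-! ### Groups, parabolic subgroups, geodesics -/

/-- A word written over `T ∪ T⁻¹` for a subset `T` of the generators. -/
def WordOver (T : Set S) (w : Word S) : Prop := ∀ l ∈ w, l.1 ∈ T

/-- The standard parabolic subgroup `A_T` generated by the image of `T ⊆ S`. -/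
def parab (A : ArtinData S) (T : Set S) : Subgroup (ArtinGroup A) :=
  Subgroup.closure {x | ∃ s ∈ T, x = wbar A [(s, true)]}

/-- A geodesic word: of minimal length among all words representing the same element. -/
def Geodesic (A : ArtinData S) (w : Word S) : Prop :=
  ∀ w' : Word S, wbar A w' = wbar A w → w.length ≤ w'.length

/-- A word over `T ∪ T⁻¹` that is geodesic among the words over `T ∪ T⁻¹` representing the
same element. -/
def GeodesicOver (A : ArtinData S) (T : Set S) (w : Word S) : Prop :=
  WordOver T w ∧
    ∀ w' : Word S, WordOver T w' → wbar A w' = wbar A w → w.length ≤ w'.length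

/-- The length of a group element: the length of any geodesic representative word. -/
noncomputable def elLength (A : ArtinData S) (g : ArtinGroup A) : ℕ :=
  sInf {n | ∃ w : Word S, wbar A w = g ∧ w.length = n}

/-- A positive element: one represented by a positive word. -/
def IsPosElt (A : ArtinData S) (g : ArtinGroup A) : Prop :=
  ∃ w : Word S, Positive w ∧ wbar A w = g

/-- An `H`-transversal: a subset containing `1` and exactly one element of each left
`H`-coset. -/
def IsLeftTransversal {G : Type*} [Group G] (H : Subgroup G) (T : Set G) : Prop :=
  (1 : G) ∈ T ∧ ∀ g : G, ∃! x, x ∈ T ∧ g⁻¹ * x ∈ H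

/-! ### Properties H, H⁺, H# -/

/-- Property `H`: `w →_{0,1,2} ε ↔ w̄ = 1`. -/
def PropertyH (A : ArtinData S) : Prop :=
  ∀ w : Word S, Steps012 A w [] ↔ wbar A w = 1

/-- Property `H⁺`: every word representing an element of a standard parabolic subgroup
`A_{S₀}` can be transformed by `→_{0,1,2⋆}` into a word over `S₀ ∪ S₀⁻¹`. -/
def PropertyHPlus (A : ArtinData S) : Prop :=
  ∀ (S₀ : Set S) (w : Word S), wbar A w ∈ parab A S₀ →
    ∃ w₀ : Word S, WordOver S₀ w₀ ∧ Steps012Star A w w₀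

/-- Property `H#` with respect to an `S`-sequence of transversals `T`. -/
def PropertyHSharpWrt (A : ArtinData S) (T : Set S → Set (ArtinGroup A)) : Prop :=
  (∀ S₀ : Set S, IsLeftTransversal (parab A S₀) (T S₀)) ∧
    ∀ (S' S₀ : Set S) (w : Word S), wbar A w ∈ parab A S' →
      ∃ v u : Word S, WordOver S' v ∧ WordOver (S' ∩ S₀) u ∧
        Steps012 A w (v ++ u) ∧ wbar A v ∈ T S₀

/-- Property `H#`: property `H#` with respect to some `S`-sequence of transversals. -/
def PropertyHSharp (A : ArtinData S) : Prop :=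
  ∃ T : Set S → Set (ArtinGroup A), PropertyHSharpWrt A T

/-! ### Critical words and the involution τ (relative to a dihedral pair) -/

/-- The permutation `δ` induced by conjugation by `Δ`, extended letterwise to words:
the identity if `M` is even, and the swap of `s` and `t` if `M` is odd. -/
noncomputable def deltaMap (s t : S) (M : ℕ) (w : Word S) : Word S :=
  if Even M then w
  else w.map fun l => (if l.1 = s then t else if l.1 = t then s else l.1, l.2)

/-- `w` is an unsigned critical word (of the dihedral pair `{s,t}` with label `M`) and
`w' = τ(w)`. -/
def UCritTauPair (A : ArtinData S) (s t : S) (M : ℕ) (w w' : Word S) : Prop :=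
  WordOver {s, t} w ∧ FreelyReduced w ∧ Unsigned w ∧ GeodesicOver A {s, t} w ∧
  pfun M w + nfun M w = M ∧
  ∃ (x y z z' : S) (wm : Word S),
    ({x, y} : Set S) = {s, t} ∧ ({z, z'} : Set S) = {s, t} ∧
    ((w = altWord x y (pfun M w) ++ wm ++ wordInv (altWord z z' (nfun M w)) ∧
      w' = wordInv (altWordR x y (nfun M w)) ++ deltaMap s t M wm ++
        altWordR z z' (pfun M w)) ∨
     (w = wordInv (altWordR x y (nfun M w)) ++ wm ++ altWordR z z' (pfun M w) ∧
      w' = altWord x y (pfun M w) ++ deltaMap s t M wm ++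
        wordInv (altWord z z' (nfun M w))))

/-- `w` is a positive critical word (of the dihedral pair `{s,t}` with label `M`) and
`w' = τ(w)`. -/
def PosCritTauPair (A : ArtinData S) (s t : S) (M : ℕ) (w w' : Word S) : Prop :=
  WordOver {s, t} w ∧ Positive w ∧ pfun M w = M ∧
  ∃ (x y : S) (wm : Word S), ({x, y} : Set S) = {s, t} ∧ pfun M wm < M ∧
    ((w = altWord x y M ++ wm ∧
      (w' = deltaMap s t M wm ++ altWordR x y M ∨
       w' = deltaMap s t M wm ++ altWordR y x M) ∧
      w'.getLast? ≠ w.getLast?) ∨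
     (w = wm ++ altWordR x y M ∧
      (w' = altWord x y M ++ deltaMap s t M wm ∨
       w' = altWord y x M ++ deltaMap s t M wm) ∧
      w'.head? ≠ w.head?))

/-- `w` is a negative critical word and `w' = τ(w)` (defined via formal inverses). -/
def NegCritTauPair (A : ArtinData S) (s t : S) (M : ℕ) (w w' : Word S) : Prop :=
  PosCritTauPair A s t M (wordInv w) (wordInv w')

/-- `w` is a critical word (unsigned, positive or negative) and `w' = τ(w)`. -/
def CritTauPair (A : ArtinData S) (s t : S) (M : ℕ) (w w' : Word S) : Prop :=
  UCritTauPair A s t M w w' ∨ PosCritTauPair A s t M w w' ∨ NegCritTauPair A s t M w w'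

/-- A type β transformation relative to the dihedral pair `{s,t}` with label `M`:
replace a critical factor `v` by `τ(v)`. -/
def StepBetaPair (A : ArtinData S) (s t : S) (M : ℕ) (w w' : Word S) : Prop :=
  ∃ (w₁ w₂ v v' : Word S), w = w₁ ++ v ++ w₂ ∧ w' = w₁ ++ v' ++ w₂ ∧
    CritTauPair A s t M v v'

/-- A type β transformation (in an Artin–Tits group): a type β transformation relative to some
dihedral standard parabolic subgroup (a pair of generators with finite label). -/
def StepBeta (A : ArtinData S) (w w' : Word S) : Prop :=
  ∃ (s t : S) (M : ℕ), s ≠ t ∧ A.m s t = (M : ℕ∞) ∧ StepBetaPair A s t M w w'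

/-! ### Restriction, direct products, Coxeter graph notions -/

/-- The Artin–Tits presentation induced on a subset `T` of the generators (the presentation of
the standard parabolic subgroup `A_T`). -/
def ArtinData.restrict (A : ArtinData S) (T : Set S) : ArtinData T where
  m a b := A.m a b
  symm a b := A.symm a b
  two_le a b h := A.two_le a b fun h' => h (Subtype.ext h')

/-- The Artin–Tits presentation on the disjoint union `S₁ ⊕ S₂` obtained from presentations on
`S₁` and `S₂` by adding the commuting relations `s₁s₂ = s₂s₁` (label `2`) for `s₁ ∈ S₁`,
`s₂ ∈ S₂`. -/
def prodData {S₁ S₂ : Type*} (A₁ : ArtinData S₁) (A₂ : ArtinData S₂) :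
    ArtinData (S₁ ⊕ S₂) where
  m x y :=
    match x, y with
    | Sum.inl a, Sum.inl b => A₁.m a b
    | Sum.inr a, Sum.inr b => A₂.m a b
    | _, _ => 2
  symm x y := by
    cases x <;> cases y
    · exact A₁.symm _ _
    · rfl
    · rfl
    · exact A₂.symm _ _
  two_le x y h := by
    cases x <;> cases y
    · exact A₁.two_le _ _ fun h' => h (congrArg Sum.inl h')
    · exact le_rfl
    · exact le_rfl
    · exact A₂.two_le _ _ fun h' => h (congrArg Sum.inr h')

/-- Adjacency in the Coxeter graph `Γ` restricted to `T`: distinct vertices of `T` joined by an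
edge (i.e. with label `≠ 2`, edges labelled `2` being removed in `Γ`). -/
def coxAdj (A : ArtinData S) (T : Set S) (x y : S) : Prop :=
  x ∈ T ∧ y ∈ T ∧ x ≠ y ∧ A.m x y ≠ 2

/-- The full subgraph of the Coxeter graph on the vertex subset `T` is connected. -/
def CoxConnected (A : ArtinData S) (T : Set S) : Prop :=
  ∀ x ∈ T, ∀ y ∈ T, Relation.ReflTransGen (coxAdj A T) x y

/-- The relator set of the Coxeter presentation on `T`: the Artin relations together with the
squares of the generators. -/
def coxRels (A : ArtinData S) (T : Set S) : Set (FreeGroup T) :=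
  rels (A.restrict T) ∪ {g | ∃ x : T, g = FreeGroup.of x * FreeGroup.of x}

/-- The induced presentation on `T` is of spherical type: its Coxeter group is finite. -/
def SphericalType (A : ArtinData S) (T : Set S) : Prop :=
  Finite (PresentedGroup (coxRels A T))

/-- The induced presentation on `T` is of large type: all labels are `≥ 3` (possibly `∞`). -/
def LargeTypeOn (A : ArtinData S) (T : Set S) : Prop :=
  ∀ x ∈ T, ∀ y ∈ T, x ≠ y → 3 ≤ A.m x y

/-! ### A normal form model for dihedral Artin–Tits groups -/

namespace Dihedral

/-- A letter of the dihedral alphabet: a name and a sign. -/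
abbrev Letter := Bool × Bool

/-- The Garside normal form of an element of the dihedral Artin–Tits group with label `M`:
`one k` is `Δ⁻ᵏ`, and `ne f c cs k` is `w Δ⁻ᵏ`, where `w` is the positive word starting with the
name `f` whose maximal alternating blocks have lengths `c :: cs`. -/
inductive Elt
  | one (k : ℤ)
  | ne (f : Bool) (c : ℕ) (cs : List ℕ) (k : ℤ)

namespace Elt

/-- The normal form with a possibly empty list of blocks. -/
def mk (f : Bool) : List ℕ → ℤ → Elt
  | [], k => one k
  | c :: cs, k => ne f c cs k

@[simp] theorem mk_nil (f : Bool) (k : ℤ) : mk f [] k = one k := rfl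

@[simp] theorem mk_cons (f : Bool) (c : ℕ) (cs : List ℕ) (k : ℤ) :
    mk f (c :: cs) k = ne f c cs k := rfl

/-- The block lengths of a normal form. -/
def blocks : Elt → List ℕ
  | one _ => []
  | ne _ c cs _ => c :: cs

/-- The opposite of the exponent of `Δ` in a normal form. -/
def pow : Elt → ℤ
  | one k => k
  | ne _ _ _ k => k

@[simp] theorem blocks_mk (f : Bool) (cs : List ℕ) (k : ℤ) : (mk f cs k).blocks = cs := by
  cases cs <;> rfl

@[simp] theorem pow_mk (f : Bool) (cs : List ℕ) (k : ℤ) : (mk f cs k).pow = k := by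
  cases cs <;> rfl

@[simp] theorem blocks_one (k : ℤ) : (one k).blocks = [] := rfl

@[simp] theorem pow_one (k : ℤ) : (one k).pow = k := rfl

@[simp] theorem blocks_ne (f : Bool) (c : ℕ) (cs : List ℕ) (k : ℤ) :
    (ne f c cs k).blocks = c :: cs := rfl

@[simp] theorem pow_ne (f : Bool) (c : ℕ) (cs : List ℕ) (k : ℤ) : (ne f c cs k).pow = k := rfl

end Elt

open Elt

/-- A normal form is valid when its blocks are proper. -/
def Valid (M : ℕ) (x : Elt) : Prop := ∀ d ∈ x.blocks, 1 ≤ d ∧ d < M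

/-- Left multiplication of a normal form by a letter. -/
def act (M : ℕ) : Letter → Elt → Elt
  | (g, true), one k => ne g 1 [] k
  | (g, true), ne f c cs k =>
      if g = f then ne g 1 (c :: cs) k
      else if c + 1 < M then ne g (c + 1) cs k else mk f cs (k - 1)
  | (g, false), one k => ne (!g) (M - 1) [] (k + 1)
  | (g, false), ne f c cs k =>
      if g = f then (if c = 1 then mk f cs k else ne (!f) (c - 1) cs k)
      else ne f (M - 1) (c :: cs) (k + 1)

/-- Left multiplication of a normal form by a word. -/
def run (M : ℕ) (u : List Letter) (x : Elt) : Elt := u.foldr (act M) x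

@[simp] theorem run_nil (M : ℕ) (x : Elt) : run M [] x = x := rfl

@[simp] theorem run_cons (M : ℕ) (l : Letter) (u : List Letter) (x : Elt) :
    run M (l :: u) x = act M l (run M u x) := rfl

@[simp] theorem run_append (M : ℕ) (u v : List Letter) (x : Elt) :
    run M (u ++ v) x = run M u (run M v x) := by
  simp [run, List.foldr_append]

theorem valid_one (M : ℕ) (k : ℤ) : Valid M (one k) := by simp [Valid]

theorem valid_mk {M : ℕ} {f : Bool} {cs : List ℕ} {k : ℤ} :
    Valid M (mk f cs k) ↔ ∀ d ∈ cs, 1 ≤ d ∧ d < M := by simp [Valid]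

theorem valid_ne {M : ℕ} {f : Bool} {c : ℕ} {cs : List ℕ} {k : ℤ} :
    Valid M (ne f c cs k) ↔ (1 ≤ c ∧ c < M) ∧ ∀ d ∈ cs, 1 ≤ d ∧ d < M := by simp [Valid]

theorem valid_act {M : ℕ} (hM : 2 ≤ M) (l : Letter) {x : Elt} (hx : Valid M x) :
    Valid M (act M l x) := by
  obtain ⟨g, b⟩ := l
  cases x with
  | one k => cases b <;> simp [act, valid_ne] <;> omega
  | ne f c cs k =>
    rw [valid_ne] at hx
    have h' : ∀ d ∈ c :: cs, 1 ≤ d ∧ d < M := by simpa using hx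
    cases b
    · simp only [act]
      split_ifs
      · exact valid_mk.2 hx.2
      · exact valid_ne.2 ⟨by omega, hx.2⟩
      · exact valid_ne.2 ⟨by omega, h'⟩
    · simp only [act]
      split_ifs
      · exact valid_ne.2 ⟨by omega, h'⟩
      · exact valid_ne.2 ⟨by omega, hx.2⟩
      · exact valid_mk.2 hx.2

theorem valid_run {M : ℕ} (hM : 2 ≤ M) (u : List Letter) {x : Elt} (hx : Valid M x) :
    Valid M (run M u x) := by
  induction u with
  | nil => exact hx
  | cons l u ih => exact valid_act hM l ih

/-- The letterwise inverse of a word, without reversal. -/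
def flipW (u : List Letter) : List Letter := u.map fun l => (l.1, !l.2)

@[simp] theorem flipW_nil : flipW [] = [] := rfl

@[simp] theorem flipW_cons (l : Letter) (u : List Letter) :
    flipW (l :: u) = (l.1, !l.2) :: flipW u := rfl

@[simp] theorem flipW_append (u v : List Letter) : flipW (u ++ v) = flipW u ++ flipW v := by
  simp [flipW]

@[simp] theorem flipW_flipW (u : List Letter) : flipW (flipW u) = u := by
  simp [flipW, Function.comp_def]

@[simp] theorem length_flipW (u : List Letter) : (flipW u).length = u.length := by simp [flipW]

/-- The automorphism of normal forms induced by `flipW`. -/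
def flipE (M : ℕ) : Elt → Elt
  | one k => one (-k)
  | ne f c cs k => ne (!f) (M - c) (cs.map (M - ·)) (cs.length + 1 - k)

theorem flipE_ne (M : ℕ) (f : Bool) (c : ℕ) (cs : List ℕ) (k : ℤ) :
    flipE M (ne f c cs k) = ne (!f) (M - c) (cs.map (M - ·)) (cs.length + 1 - k) := rfl

theorem flipE_mk (M : ℕ) (f : Bool) (cs : List ℕ) (k : ℤ) :
    flipE M (mk f cs k) = mk (!f) (cs.map (M - ·)) (cs.length - k) := by
  cases cs <;> simp [flipE]

theorem map_sub_map_sub {M : ℕ} {cs : List ℕ} (h : ∀ d ∈ cs, 1 ≤ d ∧ d < M) :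
    (cs.map (M - ·)).map (M - ·) = cs := by
  rw [List.map_map]
  conv_rhs => rw [← List.map_id cs]
  refine List.map_congr_left fun d hd => ?_
  have := h d hd
  simp; omega

theorem flipE_flipE {M : ℕ} {x : Elt} (hx : Valid M x) : flipE M (flipE M x) = x := by
  cases x with
  | one k => simp [flipE]
  | ne f c cs k =>
    rw [valid_ne] at hx
    simp only [flipE, map_sub_map_sub hx.2]
    simp; omega

theorem valid_flipE {M : ℕ} {x : Elt} (hx : Valid M x) : Valid M (flipE M x) := by
  cases x with
  | one k => exact valid_one M _
  | ne f c cs k =>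
    rw [valid_ne] at hx
    refine valid_ne.2 ⟨by omega, ?_⟩
    intro d hd
    obtain ⟨e, he, rfl⟩ := List.mem_map.1 hd
    have := hx.2 e he
    simp; omega

theorem pow_flipE (M : ℕ) (x : Elt) : (flipE M x).pow = x.blocks.length - x.pow := by
  cases x <;> simp [flipE]

theorem act_flipE {M : ℕ} (hM : 2 ≤ M) (l : Letter) {x : Elt} (hx : Valid M x) :
    act M (l.1, !l.2) (flipE M x) = flipE M (act M l x) := by
  obtain ⟨g, b⟩ := l
  cases x with
  | one k => cases b <;> simp [act, flipE] <;> omega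
  | ne f c cs k =>
    rw [valid_ne] at hx
    rw [flipE_ne]
    cases b
    · simp only [act, Bool.not_false]
      by_cases hg : g = f
      · subst hg
        rw [if_neg (by simp), if_pos rfl]
        by_cases hc : c = 1
        · rw [if_neg (by omega), if_pos hc, flipE_mk]
          congr 1; ring
        · rw [if_pos (by omega), if_neg hc]
          simp [flipE]; omega
      · have : g = !f := by cases g <;> cases f <;> simp_all
        rw [if_pos this, if_neg hg]
        simp only [flipE_ne, this, List.map_cons, List.length_cons]
        congr 1
        · omega
        · push_cast; ring
    · simp only [act, Bool.not_true]
      by_cases hg : g = f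
      · subst hg
        rw [if_neg (by simp), if_pos rfl]
        simp [flipE]; ring
      · have : g = !f := by cases g <;> cases f <;> simp_all
        rw [if_pos this, if_neg hg]
        by_cases hc : c + 1 < M
        · rw [if_neg (by omega), if_pos hc]
          simp [flipE, this]; omega
        · rw [if_pos (by omega), if_neg hc, flipE_mk]
          congr 1; ring

theorem run_flipW {M : ℕ} (hM : 2 ≤ M) (u : List Letter) {x : Elt} (hx : Valid M x) :
    run M (flipW u) (flipE M x) = flipE M (run M u x) := by
  induction u with
  | nil => rfl
  | cons l u ih => rw [flipW_cons, run_cons, ih, run_cons, act_flipE hM l (valid_run hM u hx)]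

theorem act_act_inv {M : ℕ} (hM : 2 ≤ M) (l : Letter) {x : Elt} (hx : Valid M x) :
    act M (l.1, !l.2) (act M l x) = x := by
  have key : ∀ (g : Bool) {x : Elt}, Valid M x → act M (g, false) (act M (g, true) x) = x := by
    intro g x hx
    cases x with
    | one k => simp [act]
    | ne f c cs k =>
      rw [valid_ne] at hx
      by_cases hg : g = f
      · subst hg; simp [act]
      · have hgf : g = !f := by cases g <;> cases f <;> simp_all
        by_cases hc : c + 1 < M
        · have : c ≠ 0 := by omega
          simp [act, hc, hgf, this]
        · have : M - 1 = c := by omega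
          cases cs <;> simp [act, hc, hgf, this]
  obtain ⟨g, b⟩ := l
  cases b
  · have h := key g (valid_flipE hx)
    have h1 : act M (g, true) (flipE M x) = _ := act_flipE hM (g, false) hx
    have h2 : act M (g, false) (flipE M _) = _ :=
      act_flipE hM (g, true) (valid_act hM (g, false) hx)
    rw [h1, h2] at h
    have := congrArg (flipE M) h
    rwa [flipE_flipE hx, flipE_flipE (valid_act hM _ (valid_act hM _ hx))] at this
  · exact key g hx

theorem act_inv_act {M : ℕ} (hM : 2 ≤ M) (l : Letter) {x : Elt} (hx : Valid M x) :
    act M l (act M (l.1, !l.2) x) = x := by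
  simpa using act_act_inv hM (l.1, !l.2) hx

/-! #### Alternating words and the Garside element -/

/-- The alternating word of length `n` starting with the name `f`, all letters having sign `b`. -/
def alt (f b : Bool) : ℕ → List Letter
  | 0 => []
  | n + 1 => (f, b) :: alt (!f) b n

@[simp] theorem alt_zero (f b : Bool) : alt f b 0 = [] := rfl

theorem alt_succ (f b : Bool) (n : ℕ) : alt f b (n + 1) = (f, b) :: alt (!f) b n := rfl

@[simp] theorem length_alt (f b : Bool) (n : ℕ) : (alt f b n).length = n := by
  induction n generalizing f with
  | zero => rfl
  | succ n ih => simp [alt, ih]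

theorem alt_add (f b : Bool) (m n : ℕ) :
    alt f b (m + n) = alt f b m ++ alt (f ^^ m.bodd) b n := by
  induction m generalizing f with
  | zero => simp
  | succ m ih =>
    rw [Nat.succ_add, alt_succ, ih, alt_succ]
    cases f <;> cases h : m.bodd <;> simp [h]

@[simp] theorem flipW_alt (f b : Bool) (n : ℕ) : flipW (alt f b n) = alt f (!b) n := by
  induction n generalizing f with
  | zero => rfl
  | succ n ih => simp [alt_succ, ih]

theorem run_alt_mk {M : ℕ} (f : Bool) {n : ℕ} (hn : 1 ≤ n) (hnM : n < M) (cs : List ℕ) (k : ℤ) :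
    run M (alt f true n) (mk (f ^^ (n + 1).bodd) cs k) = ne f n cs k := by
  induction n, hn using Nat.le_induction generalizing f with
  | base => cases cs <;> simp [alt, act]
  | succ n hn ih =>
    have h : (f ^^ (n + 1 + 1).bodd) = ((!f) ^^ (n + 1).bodd) := by
      cases f <;> cases h : n.bodd <;> simp [h]
    rw [alt_succ, run_cons, h, ih _ (by omega)]
    simp [act, hnM]

theorem run_alt_ne {M : ℕ} (f : Bool) (n c : ℕ) (hn : c + n < M) (cs : List ℕ)
    (k : ℤ) : run M (alt f true n) (ne (f ^^ n.bodd) c cs k) = ne f (c + n) cs k := by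
  induction n generalizing f with
  | zero => simp
  | succ n ih =>
    have h : (f ^^ (n + 1).bodd) = ((!f) ^^ n.bodd) := by
      cases f <;> cases h : n.bodd <;> simp [h]
    rw [alt_succ, run_cons, h, ih _ (by omega)]
    simp [act, hn, Nat.add_assoc]

/-- Left multiplication of a normal form by `Δʲ`. -/
def delta (M : ℕ) (j : ℤ) : Elt → Elt
  | one k => one (k - j)
  | ne f c cs k => ne (f ^^ (M.bodd && j.bodd)) c cs (k - j)

theorem delta_ne (M : ℕ) (j : ℤ) (f : Bool) (c : ℕ) (cs : List ℕ) (k : ℤ) :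
    delta M j (ne f c cs k) = ne (f ^^ (M.bodd && j.bodd)) c cs (k - j) := rfl

theorem delta_mk (M : ℕ) (j : ℤ) (f : Bool) (cs : List ℕ) (k : ℤ) :
    delta M j (mk f cs k) = mk (f ^^ (M.bodd && j.bodd)) cs (k - j) := by
  cases cs <;> rfl

theorem delta_zero (M : ℕ) (x : Elt) : delta M 0 x = x := by
  cases x <;> simp [delta]

theorem delta_add (M : ℕ) (i j : ℤ) (x : Elt) : delta M (i + j) x = delta M i (delta M j x) := by
  cases x with
  | one k => simp [delta]; ring
  | ne f c cs k =>
    simp only [delta, Int.bodd_add]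
    congr 1
    · cases f <;> cases M.bodd <;> cases i.bodd <;> cases j.bodd <;> rfl
    · ring

theorem valid_delta {M : ℕ} {j : ℤ} {x : Elt} (hx : Valid M x) : Valid M (delta M j x) := by
  cases x <;> simpa [delta, Valid] using hx

theorem act_delta (M : ℕ) (j : ℤ) (l : Letter) (x : Elt) :
    act M (l.1 ^^ (M.bodd && j.bodd), l.2) (delta M j x) = delta M j (act M l x) := by
  obtain ⟨g, b⟩ := l
  cases x with
  | one k => cases b <;> simp [act, delta] <;> ring
  | ne f c cs k =>
    generalize hq : (M.bodd && j.bodd) = q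
    have h1 : ((g ^^ q) = (f ^^ q)) ↔ g = f := by cases g <;> cases f <;> cases q <;> simp
    cases b
    · rw [delta_ne, hq]
      simp only [act, h1]
      split_ifs
      · simp [delta_mk, hq]
      · simp [delta, hq]
      · simp [delta, hq]; ring
    · rw [delta_ne, hq]
      simp only [act, h1]
      split_ifs
      · simp [delta, hq]
      · simp [delta, hq]
      · rw [delta_mk, hq]; congr 1; ring

theorem run_alt_full {M : ℕ} (hM : 2 ≤ M) (f : Bool) {x : Elt} (hx : Valid M x) :
    run M (alt f true M) x = delta M 1 x := by
  have key : ∀ (cs : List ℕ) (k : ℤ), run M (alt f true M) (mk (f ^^ (M + 1).bodd) cs k) =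
      mk (!f) cs (k - 1) := by
    intro cs k
    obtain ⟨n, rfl⟩ : ∃ n, M = n + 1 := ⟨M - 1, by omega⟩
    have h : (f ^^ (n + 1 + 1).bodd) = ((!f) ^^ (n + 1).bodd) := by
      cases f <;> cases h : n.bodd <;> simp [h]
    rw [alt_succ, run_cons, h, run_alt_mk _ (by omega) (by omega)]
    simp [act]
  cases x with
  | one k => simpa [delta] using key [] k
  | ne h c cs k =>
    rw [valid_ne] at hx
    by_cases hh : h = (f ^^ (M + 1).bodd)
    · subst hh
      rw [← mk_cons, key, delta_mk]
      congr 1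
      cases f <;> cases hb : M.bodd <;> simp [hb]
    · have hh' : h = (f ^^ M.bodd) := by
        revert hh; cases h <;> cases f <;> cases hb : M.bodd <;> simp [hb]
      obtain ⟨n, rfl⟩ : ∃ n, M = c + (n + 1) := ⟨M - c - 1, by omega⟩
      have e1 : h = ((!(f ^^ c.bodd)) ^^ n.bodd) := by
        rw [hh']; cases f <;> cases hb : c.bodd <;> cases hb' : n.bodd <;> simp [hb, hb']
      have e2 : (f ^^ c.bodd) = !(f ^^ (c + 1).bodd) := by
        cases f <;> cases hb : c.bodd <;> simp [hb]
      rw [alt_add, run_append, alt_succ, run_cons, e1, run_alt_ne _ _ _ (by omega)]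
      have e3 : act (c + (n + 1)) (f ^^ c.bodd, true) (ne (!(f ^^ c.bodd)) (c + n) cs k) =
          mk (f ^^ (c + 1).bodd) cs (k - 1) := by
        rw [e2]; simp [act]; omega
      rw [e3, run_alt_mk _ hx.1.1 (by omega)]
      simp only [delta, ← e1, hh']
      congr 1
      cases f <;> cases hb : (c + (n + 1)).bodd <;> simp

/-! #### Words described by blocks -/

/-- The word with base name `f` and blocks `L`. A block `(true, c)` is a positive alternating word
of length `c`; a block `(false, c)` is a negative one of length `M - c`. -/
def bword (M : ℕ) : Bool → List (Bool × ℕ) → List Letter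
  | _, [] => []
  | f, (true, c) :: L => alt f true c ++ bword M (f ^^ (c + 1).bodd) L
  | f, (false, c) :: L => alt (!f) false (M - c) ++ bword M (f ^^ (M + c + 1).bodd) L

/-- All blocks are proper. -/
def Proper (M : ℕ) (L : List (Bool × ℕ)) : Prop := ∀ p ∈ L, 1 ≤ p.2 ∧ p.2 < M

theorem proper_cons {M : ℕ} {p : Bool × ℕ} {L : List (Bool × ℕ)} :
    Proper M (p :: L) ↔ (1 ≤ p.2 ∧ p.2 < M) ∧ Proper M L := by simp [Proper]

theorem proper_nil (M : ℕ) : Proper M [] := by simp [Proper]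

/-- The number of negative blocks. -/
def negs (L : List (Bool × ℕ)) : ℕ := L.countP fun p => !p.1

@[simp] theorem negs_nil : negs [] = 0 := rfl

@[simp] theorem negs_true (c : ℕ) (L : List (Bool × ℕ)) : negs ((true, c) :: L) = negs L := by
  simp [negs]

@[simp] theorem negs_false (c : ℕ) (L : List (Bool × ℕ)) :
    negs ((false, c) :: L) = negs L + 1 := by simp [negs]

theorem negs_le (L : List (Bool × ℕ)) : negs L ≤ L.length := List.countP_le_length

/-- The blocks of the flipped word. -/
def flipL (M : ℕ) (L : List (Bool × ℕ)) : List (Bool × ℕ) := L.map fun p => (!p.1, M - p.2)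

theorem proper_flipL {M : ℕ} {L : List (Bool × ℕ)} (h : Proper M L) : Proper M (flipL M L) := by
  intro p hp
  obtain ⟨q, hq, rfl⟩ := List.mem_map.1 hp
  have := h q hq
  simp; omega

theorem flipW_bword {M : ℕ} (f : Bool) {L : List (Bool × ℕ)} (h : Proper M L) :
    flipW (bword M f L) = bword M (!f) (flipL M L) := by
  induction L generalizing f with
  | nil => rfl
  | cons p L ih =>
    obtain ⟨b, c⟩ := p
    rw [proper_cons] at h
    cases b
    · have e : (!(f ^^ (M + c + 1).bodd)) = ((!f) ^^ (M - c + 1).bodd) := by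
        obtain ⟨n, rfl⟩ : ∃ n, M = c + n := ⟨M - c, by have := h.1.2; simp only at this; omega⟩
        cases f <;> cases hb : c.bodd <;> cases hb' : n.bodd <;> simp [hb, hb']
      simp only [bword, flipL, List.map_cons, flipW_append, flipW_alt, ih _ h.2, Bool.not_false, e]
    · have e : (!(f ^^ (c + 1).bodd)) = ((!f) ^^ (M + (M - c) + 1).bodd) := by
        obtain ⟨n, rfl⟩ : ∃ n, M = c + n := ⟨M - c, by have := h.1.2; simp only at this; omega⟩
        cases f <;> cases hb : c.bodd <;> cases hb' : n.bodd <;> simp [hb, hb']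
      have e2 : M - (M - c) = c := by have := h.1.2; simp only at this; omega
      simp only [bword, flipL, List.map_cons, flipW_append, flipW_alt, ih _ h.2, Bool.not_true, e,
        Bool.not_not, e2]

theorem run_alt_neg {M : ℕ} (f : Bool) {c : ℕ} (hc : 1 ≤ c) (hcM : c < M) {cs : List ℕ}
    (hcs : ∀ d ∈ cs, 1 ≤ d ∧ d < M) (k : ℤ) :
    run M (alt (!f) false (M - c)) (mk (f ^^ (M + c + 1).bodd) cs k) = ne f c cs (k + 1) := by
  have hv : Valid M (mk (f ^^ (M + c + 1).bodd) cs k) := valid_mk.2 hcs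
  have e : (!(f ^^ (M + c + 1).bodd)) = ((!f) ^^ (M - c + 1).bodd) := by
    obtain ⟨n, rfl⟩ : ∃ n, M = c + n := ⟨M - c, by omega⟩
    cases f <;> cases hb : c.bodd <;> cases hb' : n.bodd <;> simp [hb, hb']
  have h := run_flipW (by omega) (alt (!f) true (M - c)) (valid_flipE hv)
  rw [flipE_flipE hv, flipW_alt, flipE_mk, e, run_alt_mk _ (by omega) (by omega)] at h
  rw [← Bool.not_true, h]
  have e2 : M - (M - c) = c := by omega
  simp only [flipE, Bool.not_not, map_sub_map_sub hcs, e2, List.length_map]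
  congr 1; ring

theorem run_bword {M : ℕ} (f : Bool) {L : List (Bool × ℕ)} (h : Proper M L) (j : ℤ) :
    run M (bword M f L) (one j) = mk f (L.map Prod.snd) (negs L + j) := by
  induction L generalizing f with
  | nil => simp [bword]
  | cons p L ih =>
    obtain ⟨b, c⟩ := p
    rw [proper_cons] at h
    cases b
    · rw [bword, run_append, ih _ h.2, run_alt_neg _ h.1.1 h.1.2]
      · simp; ring
      · intro d hd
        obtain ⟨q, hq, rfl⟩ := List.mem_map.1 hd
        exact h.2 q hq
    · rw [bword, run_append, ih _ h.2, run_alt_mk _ h.1.1 h.1.2]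
      simp

/-! #### Normal forms separate elements -/

/-- The positive word with base name `f` and blocks `cs`. -/
def posw (M : ℕ) (f : Bool) (cs : List ℕ) : List Letter := bword M f (cs.map (Prod.mk true))

theorem posw_cons (M : ℕ) (f : Bool) (c : ℕ) (cs : List ℕ) :
    posw M f (c :: cs) = alt f true c ++ posw M (f ^^ (c + 1).bodd) cs := rfl

/-- Multiplication of normal forms. -/
def mul (M : ℕ) : Elt → Elt → Elt
  | one k, y => delta M (-k) y
  | ne f c cs k, y => run M (posw M f (c :: cs)) (delta M (-k) y)

theorem mul_mk (M : ℕ) (f : Bool) (cs : List ℕ) (k : ℤ) (y : Elt) :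
    mul M (mk f cs k) y = run M (posw M f cs) (delta M (-k) y) := by
  cases cs <;> rfl

theorem run_posw_delta (M : ℕ) (f : Bool) (cs : List ℕ) (j : ℤ) (y : Elt) :
    run M (posw M (f ^^ (M.bodd && j.bodd)) cs) (delta M j y) =
      delta M j (run M (posw M f cs) y) := by
  have halt : ∀ (f : Bool) (n : ℕ) (y : Elt), run M (alt (f ^^ (M.bodd && j.bodd)) true n)
      (delta M j y) = delta M j (run M (alt f true n) y) := by
    intro f n y
    induction n generalizing f with
    | zero => rfl
    | succ n ih =>
      have : (!(f ^^ (M.bodd && j.bodd))) = ((!f) ^^ (M.bodd && j.bodd)) := by simp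
      rw [alt_succ, run_cons, this, ih, alt_succ, run_cons, ← act_delta]
  induction cs generalizing f with
  | nil => rfl
  | cons c cs ih =>
    rw [posw_cons, run_append, posw_cons, run_append, ← halt, ← ih]
    congr 3
    cases f <;> cases (c + 1).bodd <;> simp

theorem act_mul {M : ℕ} (hM : 2 ≤ M) (l : Letter) {x y : Elt} (hx : Valid M x) (hy : Valid M y) :
    act M l (mul M x y) = mul M (act M l x) y := by
  have hvm : ∀ {x : Elt}, Valid M x → Valid M (mul M x y) := by
    intro x hx
    cases x with
    | one k => exact valid_delta hy
    | ne f c cs k => exact valid_run hM _ (valid_delta hy)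
  have key : ∀ (g : Bool) {x : Elt}, Valid M x →
      act M (g, true) (mul M x y) = mul M (act M (g, true) x) y := by
    intro g x hx
    cases x with
    | one k => simp [act, mul, posw, bword, alt]
    | ne f c cs k =>
      rw [valid_ne] at hx
      by_cases hg : g = f
      · subst hg
        simp [act, mul, posw_cons, alt]
      · have hgf : f = !g := by cases g <;> cases f <;> simp_all
        have e : ((!g) ^^ (c + 1).bodd) = (g ^^ (c + 1 + 1).bodd) := by
          cases g <;> cases hb : c.bodd <;> simp [hb]
        have e0 : act M (g, true) (mul M (ne f c cs k) y) =
            run M (posw M g ((c + 1) :: cs)) (delta M (-k) y) := by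
          rw [posw_cons, alt_succ, ← e, hgf, mul, posw_cons]
          simp
        rw [e0]
        by_cases hc : c + 1 < M
        · simp [act, hg, hc, mul]
        · have hcM : c + 1 = M := by omega
          have e1 : act M (g, true) (ne f c cs k) = mk f cs (k - 1) := by simp [act, hg, hc]
          have e2 : -(k - 1) = 1 + -k := by ring
          rw [e1, mul_mk, e2, delta_add, posw_cons, run_append, hcM, run_alt_full hM]
          · rw [← run_posw_delta]
            congr 2
            rw [hgf]
            cases g <;> cases hb : M.bodd <;> simp [hb]
          · exact valid_run hM _ (valid_delta hy)
  obtain ⟨g, b⟩ := l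
  cases b
  · have h := key g (valid_act hM (g, false) hx)
    have e := act_inv_act hM (g, true) hx
    simp only [Bool.not_true] at e
    rw [e] at h
    have h2 := congrArg (act M (g, false)) h
    have e2 := act_act_inv hM (g, true) (hvm (valid_act hM (g, false) hx))
    simp only [Bool.not_true] at e2
    rw [e2] at h2
    exact h2.symm
  · exact key g hx

theorem run_eq_mul {M : ℕ} (hM : 2 ≤ M) (u : List Letter) {y : Elt} (hy : Valid M y) :
    run M u y = mul M (run M u (one 0)) y := by
  induction u with
  | nil => simp [mul, delta_zero]
  | cons l u ih =>
    rw [run_cons, ih, act_mul hM l (valid_run hM u (valid_one M 0)) hy, run_cons]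

/-- Two words represent the same element of the dihedral Artin–Tits group with label `M`. -/
def BEq (M : ℕ) (u v : List Letter) : Prop := run M u (one 0) = run M v (one 0)

theorem BEq.refl (M : ℕ) (u : List Letter) : BEq M u u := rfl

theorem BEq.symm {M : ℕ} {u v : List Letter} (h : BEq M u v) : BEq M v u := Eq.symm h

theorem BEq.trans {M : ℕ} {u v w : List Letter} (h : BEq M u v) (h' : BEq M v w) : BEq M u w :=
  Eq.trans h h'

theorem BEq.append {M : ℕ} (hM : 2 ≤ M) {u v u' v' : List Letter} (h : BEq M u v)
    (h' : BEq M u' v') : BEq M (u ++ u') (v ++ v') := by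
  have hv := valid_run hM v' (valid_one M 0)
  unfold BEq at *
  rw [run_append, run_append, h', run_eq_mul hM u hv, h, ← run_eq_mul hM v hv]

theorem BEq.cons {M : ℕ} {u v : List Letter} (l : Letter) (h : BEq M u v) :
    BEq M (l :: u) (l :: v) := congrArg (act M l) h

theorem beq_cancel {M : ℕ} (hM : 2 ≤ M) (l : Letter) (u : List Letter) :
    BEq M (l :: (l.1, !l.2) :: u) u :=
  act_inv_act hM l (valid_run hM u (valid_one M 0))

theorem beq_cancel' {M : ℕ} (hM : 2 ≤ M) (l : Letter) (u : List Letter) :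
    BEq M ((l.1, !l.2) :: l :: u) u :=
  act_act_inv hM l (valid_run hM u (valid_one M 0))

theorem BEq.of_cons {M : ℕ} (hM : 2 ≤ M) {l : Letter} {u v : List Letter}
    (h : BEq M (l :: u) (l :: v)) : BEq M u v :=
  ((beq_cancel' hM l u).symm.trans (h.cons _)).trans (beq_cancel' hM l v)

theorem beq_alt {M : ℕ} (hM : 2 ≤ M) (f g : Bool) : BEq M (alt f true M) (alt g true M) := by
  unfold BEq
  rw [run_alt_full hM f (valid_one M 0), run_alt_full hM g (valid_one M 0)]

theorem BEq.flip {M : ℕ} (hM : 2 ≤ M) {u v : List Letter} (h : BEq M u v) :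
    BEq M (flipW u) (flipW v) := by
  have e : one 0 = flipE M (one 0) := by simp [flipE]
  unfold BEq at *
  rw [e, run_flipW hM u (valid_one M 0), run_flipW hM v (valid_one M 0), h]

/-! #### Geodesics -/

/-- The exponent sum of a word. -/
def expSum (u : List Letter) : ℤ := (u.map fun l => if l.2 then (1 : ℤ) else -1).sum

@[simp] theorem expSum_nil : expSum [] = 0 := rfl

@[simp] theorem expSum_cons (l : Letter) (u : List Letter) :
    expSum (l :: u) = (if l.2 then 1 else -1) + expSum u := by simp [expSum]

/-- The exponent sum of a normal form. -/
def ell (M : ℕ) (x : Elt) : ℤ := x.blocks.sum - M * x.pow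

theorem ell_act {M : ℕ} (hM : 2 ≤ M) (l : Letter) {x : Elt} (hx : Valid M x) :
    ell M (act M l x) = (if l.2 then 1 else -1) + ell M x := by
  obtain ⟨g, b⟩ := l
  cases x with
  | one k =>
    cases b
    · simp only [act, ell, blocks_ne, pow_ne, blocks_one, pow_one]
      have : ((M - 1 : ℕ) : ℤ) = M - 1 := by omega
      simp [this]; ring
    · simp [act, ell]; ring
  | ne f c cs k =>
    rw [valid_ne] at hx
    cases b
    · simp only [act, Bool.false_eq_true, if_false]
      split_ifs
      · simp_all [ell]; ring
      · have : ((c - 1 : ℕ) : ℤ) = c - 1 := by omega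
        simp [ell, this]; ring
      · have : ((M - 1 : ℕ) : ℤ) = M - 1 := by omega
        simp [ell, this]; ring
    · simp only [act]
      split_ifs
      · simp [ell]; ring
      · simp [ell]; ring
      · have : (M : ℤ) = c + 1 := by omega
        simp [ell, this]; ring

theorem ell_run {M : ℕ} (hM : 2 ≤ M) (u : List Letter) :
    ell M (run M u (one 0)) = expSum u := by
  induction u with
  | nil => simp [ell]
  | cons l u ih => rw [run_cons, ell_act hM l (valid_run hM u (valid_one M 0)), ih, expSum_cons]

theorem BEq.expSum_eq {M : ℕ} (hM : 2 ≤ M) {u v : List Letter} (h : BEq M u v) :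
    expSum u = expSum v := by
  rw [← ell_run hM, ← ell_run hM, h]

/-- All letters are positive. -/
def Pos (u : List Letter) : Prop := ∀ l ∈ u, l.2 = true

theorem pos_cons {l : Letter} {u : List Letter} : Pos (l :: u) ↔ l.2 = true ∧ Pos u := by
  simp [Pos]

theorem pos_nil : Pos [] := by simp [Pos]

theorem pos_append {u v : List Letter} : Pos (u ++ v) ↔ Pos u ∧ Pos v := by
  simp [Pos, or_imp, forall_and]

theorem pos_alt (f : Bool) (n : ℕ) : Pos (alt f true n) := by
  induction n generalizing f with
  | zero => exact pos_nil
  | succ n ih => exact pos_cons.2 ⟨rfl, ih _⟩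

theorem expSum_le (u : List Letter) : expSum u ≤ u.length := by
  induction u with
  | nil => simp
  | cons l u ih =>
    simp only [expSum_cons, List.length_cons]
    split_ifs <;> push_cast <;> omega

theorem pos_iff (u : List Letter) : Pos u ↔ expSum u = u.length := by
  induction u with
  | nil => simp [Pos]
  | cons l u ih =>
    have := expSum_le u
    rw [pos_cons, ih]
    simp only [expSum_cons, List.length_cons]
    split_ifs with h <;> simp only [h] <;> push_cast <;> simp <;> omega

theorem expSum_parity (u : List Letter) : expSum u % 2 = (u.length : ℤ) % 2 := by
  induction u with
  | nil => simp
  | cons l u ih =>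
    simp only [expSum_cons, List.length_cons]
    split_ifs <;> push_cast <;> omega

/-- A word is geodesic when it has minimal length among the words representing its element. -/
def Geo (M : ℕ) (u : List Letter) : Prop := ∀ v, BEq M v u → u.length ≤ v.length

theorem Geo.length_eq {M : ℕ} {u v : List Letter} (hu : Geo M u) (hv : Geo M v)
    (h : BEq M u v) : u.length = v.length :=
  le_antisymm (hu v h.symm) (hv u h)

theorem Geo.of_beq {M : ℕ} {u v : List Letter} (hu : Geo M u) (h : BEq M u v)
    (hl : v.length ≤ u.length) : Geo M v :=
  fun w hw => hl.trans (hu w (hw.trans h.symm))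

theorem Geo.tail {M : ℕ} {l : Letter} {u : List Letter} (h : Geo M (l :: u)) : Geo M u := by
  intro v hv
  simpa using h (l :: v) (hv.cons l)

theorem Geo.drop {M : ℕ} {u v : List Letter} (h : Geo M (u ++ v)) : Geo M v := by
  induction u with
  | nil => exact h
  | cons l u ih => exact ih h.tail

theorem Geo.not_inv {M : ℕ} (hM : 2 ≤ M) {l : Letter} {u : List Letter} :
    ¬ Geo M (l :: (l.1, !l.2) :: u) := by
  intro h
  have := h u (beq_cancel hM l u).symm
  simp at this

theorem Geo.flip {M : ℕ} (hM : 2 ≤ M) {u : List Letter} (h : Geo M u) : Geo M (flipW u) := by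
  intro v hv
  have := hv.flip hM
  rw [flipW_flipW] at this
  simpa using h _ this

theorem BEq.length_parity {M : ℕ} (hM : 2 ≤ M) {u v : List Letter} (h : BEq M u v) :
    u.length % 2 = v.length % 2 := by
  have h1 := expSum_parity u
  have h2 := expSum_parity v
  rw [h.expSum_eq hM] at h1
  omega

theorem Geo.exists_of_not_cons {M : ℕ} (hM : 2 ≤ M) {c : Letter} {u : List Letter}
    (hu : Geo M u) (hc : ¬ Geo M (c :: u)) :
    ∃ k, BEq M u ((c.1, !c.2) :: k) ∧ Geo M ((c.1, !c.2) :: k) := by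
  unfold Geo at hc
  push Not at hc
  obtain ⟨k, hk, hlt⟩ := hc
  have hb : BEq M u ((c.1, !c.2) :: k) := ((hk.cons _).trans (beq_cancel' hM c u)).symm
  have hp := hk.length_parity hM
  refine ⟨k, hb, hu.of_beq hb ?_⟩
  simp at hp hlt ⊢
  omega

/-! #### Positive words -/

theorem exists_pos {M : ℕ} (hM : 2 ≤ M) {x : Elt} (hx : Valid M x) (hp : x.pow ≤ 0) :
    ∃ p, Pos p ∧ run M p (one 0) = x := by
  have key : ∀ n : ℕ, ∃ p, Pos p ∧ run M p (one 0) = one (-n) := by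
    intro n
    induction n with
    | zero => exact ⟨[], pos_nil, by simp⟩
    | succ n ih =>
      obtain ⟨p, hp, h⟩ := ih
      refine ⟨alt true true M ++ p, pos_append.2 ⟨pos_alt _ _, hp⟩, ?_⟩
      rw [run_append, h, run_alt_full hM _ (valid_one M _)]
      simp [delta]; ring
  have hposw : ∀ (f : Bool) (cs : List ℕ), Pos (posw M f cs) := by
    intro f cs
    induction cs generalizing f with
    | nil => exact pos_nil
    | cons c cs ih => rw [posw_cons]; exact pos_append.2 ⟨pos_alt _ _, ih _⟩
  have main : ∀ (f : Bool) (cs : List ℕ) (k : ℤ), (∀ d ∈ cs, 1 ≤ d ∧ d < M) → k ≤ 0 →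
      ∃ p, Pos p ∧ run M p (one 0) = mk f cs k := by
    intro f cs k hcs hk
    obtain ⟨p, hp, h⟩ := key k.natAbs
    refine ⟨posw M f cs ++ p, pos_append.2 ⟨hposw _ _, hp⟩, ?_⟩
    have e : (-(k.natAbs : ℤ)) = k := by omega
    rw [run_append, h, e, posw, run_bword]
    · have : negs (cs.map (Prod.mk true)) = 0 := by simp [negs]
      rw [this, List.map_map]
      simp [Function.comp_def]
    · intro q hq
      obtain ⟨d, hd, rfl⟩ := List.mem_map.1 hq
      exact hcs d hd
  cases x with
  | one k => exact main true [] k (by simp) hp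
  | ne f c cs k => exact main f (c :: cs) k (by simpa using valid_ne.1 hx) hp

theorem Geo.pos {M : ℕ} (hM : 2 ≤ M) {u : List Letter} (hu : Geo M u)
    (hp : (run M u (one 0)).pow ≤ 0) : Pos u := by
  obtain ⟨p, hpp, h⟩ := exists_pos hM (valid_run hM u (valid_one M 0)) hp
  have h1 : BEq M p u := h
  have h2 := hu p h1
  have h3 := h1.expSum_eq hM
  rw [(pos_iff p).1 hpp] at h3
  have h4 := expSum_le u
  exact (pos_iff u).2 (by omega)

theorem pow_act_true_le (M : ℕ) (g : Bool) (x : Elt) :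
    (act M (g, true) x).pow ≤ x.pow := by
  cases x with
  | one k => simp [act]
  | ne f c cs k => simp only [act]; split_ifs <;> simp

theorem pow_act_false_le (M : ℕ) (g : Bool) (x : Elt) :
    (act M (g, false) x).pow ≤ x.pow + 1 := by
  cases x with
  | one k => simp [act]
  | ne f c cs k => simp only [act]; split_ifs <;> simp

theorem Pos.pow_le {M : ℕ} {u : List Letter} (hu : Pos u) : (run M u (one 0)).pow ≤ 0 := by
  induction u with
  | nil => simp
  | cons l u ih =>
    rw [pos_cons] at hu
    obtain ⟨g, b⟩ := l
    obtain ⟨rfl, hu⟩ := hu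
    exact (pow_act_true_le M g _).trans (ih hu)

/-- The first letter of a positive word not divisible by `Δ`. -/
theorem Pos.head_eq {M : ℕ} {g : Bool} {u : List Letter} (hu : Pos u) {f : Bool} {c : ℕ}
    {cs : List ℕ} (h : run M ((g, true) :: u) (one 0) = ne f c cs 0) : f = g := by
  have hp := hu.pow_le (M := M)
  rw [run_cons] at h
  generalize run M u (one 0) = x at h hp
  cases x with
  | one k => simp [act] at h; exact h.1.symm
  | ne f' c' cs' k =>
    simp only [act] at h
    split_ifs at h
    · simp at h; exact h.1.symm
    · simp at h; exact h.1.symm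
    · have := congrArg Elt.pow h
      simp at this hp
      omega

theorem pow_of_heads {M : ℕ} {f g : Bool} (hfg : f ≠ g) {u v : List Letter} (hu : Pos u)
    (hv : Pos v) (h : BEq M ((f, true) :: u) ((g, true) :: v)) :
    (run M ((f, true) :: u) (one 0)).pow ≤ -1 := by
  by_contra hcon
  have hp : (run M ((f, true) :: u) (one 0)).pow ≤ 0 :=
    Pos.pow_le (pos_cons.2 ⟨rfl, hu⟩)
  have h0 : (run M ((f, true) :: u) (one 0)).pow = 0 := by omega
  cases hx : run M ((f, true) :: u) (one 0) with
  | one k =>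
    rw [hx] at h0
    rw [run_cons] at hx
    have hpu := hu.pow_le (M := M)
    generalize run M u (one 0) = y at hx hpu
    cases y with
    | one j => simp [act] at hx
    | ne f' c' cs' j =>
      simp only [act] at hx
      split_ifs at hx
      have := congrArg Elt.pow hx
      simp at this h0 hpu
      omega
  | ne f' c cs k =>
    rw [hx] at h0
    simp at h0
    subst h0
    have e1 := hu.head_eq hx
    have e2 := hv.head_eq (Eq.trans (Eq.symm h) hx)
    exact hfg (e1.symm.trans e2)

/-! #### Classification of geodesics -/

theorem run_flipW_one {M : ℕ} (hM : 2 ≤ M) (u : List Letter) :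
    run M (flipW u) (one 0) = flipE M (run M u (one 0)) := by
  simpa [flipE] using run_flipW hM u (valid_one M 0)

theorem bword_length_ge {M : ℕ} (f : Bool) {L : List (Bool × ℕ)} (h : Proper M L) :
    L.length ≤ (bword M f L).length := by
  induction L generalizing f with
  | nil => simp
  | cons p L ih =>
    obtain ⟨b, c⟩ := p
    rw [proper_cons] at h
    have h1 := h.1
    simp only at h1
    cases b
    · have := ih (f ^^ (M + c + 1).bodd) h.2
      simp only [bword, length_append, length_alt, length_cons]; omega
    · have := ih (f ^^ (c + 1).bodd) h.2
      simp only [bword, length_append, length_alt, length_cons]; omega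

theorem bword_length_indep {M : ℕ} (f g : Bool) (L : List (Bool × ℕ)) :
    (bword M f L).length = (bword M g L).length := by
  induction L generalizing f g with
  | nil => simp [bword]
  | cons p L ih =>
    obtain ⟨b, c⟩ := p
    cases b
    · simpa [bword] using ih _ _
    · simpa [bword] using ih _ _

theorem exists_positive_flip {M : ℕ} {L : List (Bool × ℕ)} (hL : Proper M L) (hn : 1 ≤ negs L) :
    ∃ L', Proper M L' ∧ L'.map Prod.snd = L.map Prod.snd ∧ negs L' + 1 = negs L ∧
      ∀ f g, (bword M f L').length < (bword M g L).length + M := by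
  induction L with
  | nil => simp at hn
  | cons p L ih =>
    obtain ⟨b, c⟩ := p
    rw [proper_cons] at hL
    have h1 := hL.1
    simp only at h1
    cases b
    · refine ⟨(true, c) :: L, proper_cons.2 ⟨h1, hL.2⟩, rfl, by simp, fun f g => ?_⟩
      have := bword_length_indep (M := M) (f ^^ (c + 1).bodd) (g ^^ (M + c + 1).bodd) L
      simp only [bword, length_append, length_alt]; omega
    · obtain ⟨L', h2, h3, h4, h5⟩ := ih hL.2 (by simpa using hn)
      refine ⟨(true, c) :: L', proper_cons.2 ⟨h1, h2⟩, by simp [h3], by simpa using h4,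
        fun f g => ?_⟩
      have := h5 (f ^^ (c + 1).bodd) (g ^^ (c + 1).bodd)
      simp only [bword, length_append, length_alt]; omega

theorem bword_beq_of_flip {M : ℕ} {u : List Letter} {f : Bool}
    {L : List (Bool × ℕ)} (hL : Proper M L) (h : flipW u = bword M f L) :
    u = bword M (!f) (flipL M L) := by
  rw [← flipW_bword f hL, ← h, flipW_flipW]

theorem Geo.mixed_cons_true {M : ℕ} (hM : 2 ≤ M) {g f : Bool} {L : List (Bool × ℕ)}
    (hL : Proper M L) (hu : Geo M ((g, true) :: bword M f L))
    (hp : 0 ≤ (run M ((g, true) :: bword M f L) (one 0)).pow) :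
    ∃ f' L', Proper M L' ∧ (g, true) :: bword M f L = bword M f' L' := by
  match L, hL with
  | [], hL =>
    exact ⟨g, [(true, 1)], by simp [Proper]; omega, by simp [bword, alt]⟩
  | (b, c) :: L, hL =>
    by_cases hg : g = f
    · subst hg
      refine ⟨g, (true, 1) :: (b, c) :: L, proper_cons.2 ⟨by simp; omega, hL⟩, ?_⟩
      rw [bword.eq_2 M g 1]
      simp [alt]
    · have hgf : f = !g := by cases g <;> cases f <;> simp_all
      have hr := run_bword f hL 0
      have h0 := proper_cons.1 hL
      have h1 := h0.1
      simp only at h1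
      cases b
      · exfalso
        obtain ⟨n, hn⟩ : ∃ n, M - c = n + 1 := ⟨M - c - 1, by omega⟩
        rw [bword, hn, alt_succ, hgf, Bool.not_not] at hu
        exact Geo.not_inv hM (l := (g, true)) hu
      · by_cases hc : c + 1 < M
        · refine ⟨g, (true, c + 1) :: L, proper_cons.2 ⟨⟨by simp, hc⟩, h0.2⟩, ?_⟩
          simp only [bword, alt_succ, hgf, List.cons_append]
          congr 3
          cases g <;> cases hb : c.bodd <;> simp [hb]
        · exfalso
          have e : run M ((g, true) :: bword M f ((true, c) :: L)) (one 0) =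
              mk f (L.map Prod.snd) (negs L - 1) := by
            rw [run_cons, hr]
            simp [act, hg, hc]
          rw [e] at hp
          simp at hp
          obtain ⟨L', h2, h3, h4, h5⟩ := exists_positive_flip h0.2 hp
          have h6 : BEq M (bword M f L') ((g, true) :: bword M f ((true, c) :: L)) := by
            unfold BEq
            rw [e, run_bword f h2, h3]
            congr 1
            omega
          have h7 := hu _ h6
          have h8 := h5 f (f ^^ (c + 1).bodd)
          simp only [bword, length_append, length_alt, length_cons] at h7
          omega

/-- A geodesic whose normal form is neither positive nor negative of a divisible kind is
described by blocks. -/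
theorem Geo.mixed {M : ℕ} (hM : 2 ≤ M) {u : List Letter} (hu : Geo M u)
    (hp : 0 ≤ (run M u (one 0)).pow)
    (hp' : (run M u (one 0)).pow ≤ (run M u (one 0)).blocks.length) :
    ∃ f L, Proper M L ∧ u = bword M f L := by
  induction u with
  | nil => exact ⟨true, [], proper_nil M, rfl⟩
  | cons c u ih =>
    have hv := valid_run hM u (valid_one M 0)
    have hgp : ∀ {c : Letter} {u : List Letter}, Geo M (c :: u) →
        0 ≤ (run M (c :: u) (one 0)).pow → 0 ≤ (run M u (one 0)).pow := by
      intro c u hu hp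
      by_contra hneg
      obtain ⟨g, b⟩ := c
      cases b
      · have h1 : (run M ((g, false) :: u) (one 0)).pow ≤ 0 :=
          (pow_act_false_le M g (run M u (one 0))).trans (by omega)
        have := (pos_cons.1 (hu.pos hM h1)).1
        simp at this
      · have := pow_act_true_le M g (run M u (one 0))
        rw [run_cons] at hp
        omega
    have h1 := hgp hu hp
    have h2 : (run M u (one 0)).pow ≤ (run M u (one 0)).blocks.length := by
      have h3 := hgp (c := (c.1, !c.2)) (u := flipW u) (hu.flip hM) (by
        rw [← flipW_cons, run_flipW_one hM, pow_flipE]; omega)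
      rw [run_flipW_one hM, pow_flipE] at h3
      omega
    obtain ⟨f, L, hL, rfl⟩ := ih hu.tail h1 h2
    obtain ⟨g, b⟩ := c
    cases b
    · have hfw := flipW_bword f hL
      have hu' := hu.flip hM
      have hp'' : 0 ≤ (run M (flipW ((g, false) :: bword M f L)) (one 0)).pow := by
        rw [run_flipW_one hM, pow_flipE]; omega
      rw [flipW_cons, hfw] at hu' hp''
      obtain ⟨f', L', hL', h⟩ := hu'.mixed_cons_true hM (proper_flipL hL) hp''
      refine ⟨!f', flipL M L', proper_flipL hL', bword_beq_of_flip hL' ?_⟩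
      rw [flipW_cons, hfw, ← h, Bool.not_false]
    · exact hu.mixed_cons_true hM hL hp

/-- Geodesics are positive, negative, or described by blocks. -/
theorem Geo.cases {M : ℕ} (hM : 2 ≤ M) {u : List Letter} (hu : Geo M u) :
    ((run M u (one 0)).pow ≤ 0 ∧ Pos u) ∨
    ((run M u (one 0)).blocks.length ≤ (run M u (one 0)).pow ∧ Pos (flipW u)) ∨
    (0 ≤ (run M u (one 0)).pow ∧ (run M u (one 0)).pow ≤ (run M u (one 0)).blocks.length ∧
      ∃ f L, Proper M L ∧ u = bword M f L) := by
  by_cases h1 : (run M u (one 0)).pow ≤ 0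
  · exact Or.inl ⟨h1, hu.pos hM h1⟩
  by_cases h2 : (run M u (one 0)).blocks.length ≤ (run M u (one 0)).pow
  · refine Or.inr (Or.inl ⟨h2, (hu.flip hM).pos hM ?_⟩)
    rw [run_flipW_one hM, pow_flipE]
    omega
  · exact Or.inr (Or.inr ⟨by omega, by omega, hu.mixed hM (by omega) (by omega)⟩)

/-! #### Connecting words with the same value -/

/-- The equivalence relation on words generated by the moves of types 1 and 2. -/
inductive Conn (M : ℕ) : List Letter → List Letter → Prop
  | refl (u) : Conn M u u
  | symm {u v} : Conn M u v → Conn M v u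
  | trans {u v w} : Conn M u v → Conn M v w → Conn M u w
  | cons (l) {u v} : Conn M u v → Conn M (l :: u) (l :: v)
  | full (f b w) : Conn M (alt f b M ++ w) (alt (!f) b M ++ w)
  | swap (g a c w) : 1 ≤ a → a < M → 1 ≤ c → c < M →
      Conn M (alt (g ^^ (a + 1).bodd) false a ++ (alt (!g) true c ++ w))
        (alt (g ^^ a.bodd) true (M - a) ++ (alt (g ^^ M.bodd) false (M - c) ++ w))

theorem Conn.append_left {M : ℕ} (u : List Letter) {v w : List Letter} (h : Conn M v w) :
    Conn M (u ++ v) (u ++ w) := by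
  induction u with
  | nil => exact h
  | cons l u ih => exact ih.cons l

theorem Conn.flip {M : ℕ} {u v : List Letter} (h : Conn M u v) : Conn M (flipW u) (flipW v) := by
  induction h with
  | refl u => exact Conn.refl _
  | symm _ ih => exact ih.symm
  | trans _ _ ih ih' => exact ih.trans ih'
  | cons l _ ih => exact ih.cons _
  | full f b w => simpa using Conn.full f (!b) (flipW w)
  | swap g a c w h1 h2 h3 h4 =>
    have := Conn.swap (M := M) ((!g) ^^ M.bodd) (M - a) (M - c) (flipW w) (by omega) (by omega)
      (by omega) (by omega)
    obtain ⟨n, rfl⟩ : ∃ n, M = a + n := ⟨M - a, by omega⟩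
    have e1 : a + n - (a + n - a) = a := by omega
    have e2 : a + n - (a + n - c) = c := by omega
    have e3 : a + n - a = n := by omega
    have e4 : (((!g) ^^ (a + n).bodd) ^^ (n + 1).bodd) = (g ^^ a.bodd) := by
      cases g <;> cases ha : a.bodd <;> cases hn : n.bodd <;> simp [ha, hn]
    have e5 : (((!g) ^^ (a + n).bodd) ^^ n.bodd) = (g ^^ (a + 1).bodd) := by
      cases g <;> cases ha : a.bodd <;> cases hn : n.bodd <;> simp [ha, hn]
    have e6 : (!((!g) ^^ (a + n).bodd)) = (g ^^ (a + n).bodd) := by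
      cases g <;> cases ha : a.bodd <;> cases hn : n.bodd <;> simp [ha, hn]
    have e7 : (((!g) ^^ (a + n).bodd) ^^ (a + n).bodd) = !g := by
      cases g <;> cases ha : a.bodd <;> cases hn : n.bodd <;> simp [ha, hn]
    rw [e1, e2, e3, e4, e5, e6, e7] at this
    simpa [e3] using this.symm

theorem Conn.of_pos {M : ℕ} (hM : 2 ≤ M) {u v : List Letter} (hu : Pos u) (hv : Pos v)
    (h : BEq M u v) : Conn M u v := by
  have hlen : u.length = v.length := by
    have := h.expSum_eq hM
    rw [(pos_iff u).1 hu, (pos_iff v).1 hv] at this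
    exact_mod_cast this
  induction hn : u.length generalizing u v with
  | zero =>
    rw [List.length_eq_zero_iff] at hn
    subst hn
    have : v = [] := List.length_eq_zero_iff.1 hlen.symm
    subst this
    exact Conn.refl _
  | succ n ih =>
    match u, v, hn, hlen with
    | (f, b) :: u, (g, b') :: v, hn, hlen =>
      rw [pos_cons] at hu hv
      obtain ⟨hb, hu⟩ := hu
      obtain ⟨hb', hv⟩ := hv
      simp only at hb hb'
      subst hb hb'
      simp only [length_cons, add_left_inj] at hn hlen
      by_cases hfg : f = g
      · subst hfg
        exact (ih hu hv (h.of_cons hM) hlen hn).cons _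
      · have hp := pow_of_heads hfg hu hv h
        have hval := valid_run hM ((f, true) :: u) (valid_one M 0)
        generalize hx : run M ((f, true) :: u) (one 0) = x at hp hval
        obtain ⟨p, hpp, hpr⟩ := exists_pos hM (valid_delta (j := -1) hval)
          (show (delta M (-1) x).pow ≤ 0 by cases x <;> simp [delta] at hp ⊢ <;> omega)
        have hdd : ∀ g, run M (alt g true M ++ p) (one 0) = x := by
          intro g
          rw [run_append, hpr, run_alt_full hM g (valid_delta hval), ← delta_add]
          simp [delta_zero]
        obtain ⟨m, rfl⟩ : ∃ m, M = m + 1 := ⟨M - 1, by omega⟩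
        have key : ∀ (f : Bool) (u : List Letter), Pos u → u.length = n →
            run (m + 1) ((f, true) :: u) (one 0) = x →
            Conn (m + 1) ((f, true) :: u) (alt f true (m + 1) ++ p) := by
          intro f u hu hn hx
          have h1 : BEq (m + 1) ((f, true) :: u) ((f, true) :: (alt (!f) true m ++ p)) :=
            Eq.trans hx (hdd f).symm
          have h2 := h1.of_cons hM
          have hpos : Pos (alt (!f) true m ++ p) := pos_append.2 ⟨pos_alt _ _, hpp⟩
          have h3 := h2.expSum_eq hM
          rw [(pos_iff u).1 hu, (pos_iff _).1 hpos] at h3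
          exact (ih hu hpos h2 (by exact_mod_cast h3) hn).cons _
        have hgf : g = !f := by cases g <;> cases f <;> simp_all
        have c1 := key f u hu hn hx
        have c2 := key g v hv (hlen.symm.trans hn) (Eq.trans (Eq.symm h) hx)
        have c3 : Conn (m + 1) (alt f true (m + 1) ++ p) (alt g true (m + 1) ++ p) := by
          rw [hgf]; exact Conn.full f true p
        exact c1.trans (c3.trans c2.symm)

/-- The sign pattern with all negative blocks first. -/
def canon : List ℕ → ℕ → List (Bool × ℕ)
  | [], _ => []
  | c :: cs, 0 => (true, c) :: canon cs 0
  | c :: cs, n + 1 => (false, c) :: canon cs n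

theorem conn_swap {M : ℕ} (f : Bool) {c d : ℕ} (L : List (Bool × ℕ)) (hc : 1 ≤ c) (hc' : c < M)
    (hd : 1 ≤ d) (hd' : d < M) :
    Conn M (bword M f ((false, c) :: (true, d) :: L)) (bword M f ((true, c) :: (false, d) :: L)) := by
  obtain ⟨n, rfl⟩ : ∃ n, M = c + n := ⟨M - c, by omega⟩
  have e1 : c + n - c = n := by omega
  have e2 : c + n - n = c := by omega
  have := Conn.swap (M := c + n) (f ^^ n.bodd) n d
    (bword (c + n) (f ^^ (c + n + c + 1).bodd ^^ (d + 1).bodd) L) (by omega) (by omega) hd hd'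
  simp only [bword, e1]
  rw [e2] at this
  convert this using 3
  · cases f <;> cases hb : n.bodd <;> simp [hb]
  · congr 1
    cases f <;> cases hb : n.bodd <;> cases hb' : c.bodd <;> simp [hb, hb']
  · cases f <;> cases hb : n.bodd <;> simp
  · cases f <;> cases hb : n.bodd <;> cases hb' : c.bodd <;> simp [hb, hb']
  · congr 1
    cases f <;> cases hb : n.bodd <;> cases hb' : c.bodd <;> cases hd : d.bodd <;>
      simp [hb, hb', hd]

theorem Conn.bword_cons {M : ℕ} (f : Bool) (p : Bool × ℕ) {L L' : List (Bool × ℕ)}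
    (h : ∀ f, Conn M (bword M f L) (bword M f L')) :
    Conn M (bword M f (p :: L)) (bword M f (p :: L')) := by
  obtain ⟨b, c⟩ := p
  cases b
  · exact Conn.append_left _ (h _)
  · exact Conn.append_left _ (h _)

theorem conn_canon {M : ℕ} (f : Bool) {L : List (Bool × ℕ)} (hL : Proper M L) :
    Conn M (bword M f L) (bword M f (canon (L.map Prod.snd) (negs L))) := by
  have key : ∀ (cs : List ℕ), (∀ d ∈ cs, 1 ≤ d ∧ d < M) → ∀ (c n : ℕ) (f : Bool), 1 ≤ c → c < M →
      n ≤ cs.length →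
      Conn M (bword M f ((true, c) :: canon cs n)) (bword M f (canon (c :: cs) n)) := by
    intro cs hcs
    induction cs with
    | nil =>
      intro c n f _ _ hn
      obtain rfl : n = 0 := by simpa using hn
      exact Conn.refl _
    | cons d cs ih =>
      intro c n f hc hc' hn
      cases n with
      | zero => exact Conn.refl _
      | succ n =>
        have hd := hcs d (by simp)
        refine (conn_swap f _ hc hc' hd.1 hd.2).symm.trans (Conn.bword_cons f (false, c) ?_)
        intro f
        exact ih (fun e he => hcs e (by simp [he])) d n f hd.1 hd.2 (by simpa using hn)
  induction L generalizing f with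
  | nil => exact Conn.refl _
  | cons p L ih =>
    obtain ⟨b, c⟩ := p
    rw [proper_cons] at hL
    have h1 := Conn.bword_cons f (b, c) (fun f => ih f hL.2)
    cases b
    · simpa [canon] using h1
    · have h2 := key (L.map Prod.snd) (by
        intro d hd
        obtain ⟨q, hq, rfl⟩ := List.mem_map.1 hd
        exact hL.2 q hq) c (negs L) f hL.1.1 hL.1.2 (by simpa using negs_le L)
      simpa using h1.trans h2

theorem bword_base {M : ℕ} {f g : Bool} {L L' : List (Bool × ℕ)} (hL : Proper M L)
    (hL' : Proper M L') (h : BEq M (bword M f L) (bword M g L')) :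
    L.map Prod.snd = L'.map Prod.snd ∧ negs L = negs L' ∧ (L ≠ [] → f = g) := by
  unfold BEq at h
  rw [run_bword f hL, run_bword g hL'] at h
  have h1 := congrArg Elt.blocks h
  have h2 := congrArg Elt.pow h
  simp at h1 h2
  refine ⟨h1, h2, fun hne => ?_⟩
  match L, L', h1 with
  | p :: L, q :: L', h1 =>
    simp at h
    exact h.1

/-- Geodesics with the same value are connected by moves. -/
theorem Geo.conn {M : ℕ} (hM : 2 ≤ M) {u v : List Letter} (hu : Geo M u) (hv : Geo M v)
    (h : BEq M u v) : Conn M u v := by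
  have h' := h
  unfold BEq at h'
  by_cases h1 : (run M u (one 0)).pow ≤ 0
  · exact Conn.of_pos hM (hu.pos hM h1) (hv.pos hM (h' ▸ h1)) h
  by_cases h2 : (run M u (one 0)).blocks.length ≤ (run M u (one 0)).pow
  · have key : ∀ w, Geo M w → run M w (one 0) = run M u (one 0) → Pos (flipW w) := by
      intro w hw e
      refine (hw.flip hM).pos hM ?_
      rw [run_flipW_one hM, pow_flipE, e]
      omega
    have := (Conn.of_pos hM (key u hu rfl) (key v hv h'.symm) (h.flip hM)).flip
    simpa using this
  · obtain ⟨f, L, hL, rfl⟩ := hu.mixed hM (by omega) (by omega)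
    obtain ⟨g, L', hL', rfl⟩ := hv.mixed hM (by rw [← h']; omega) (by rw [← h']; omega)
    obtain ⟨e1, e2, e3⟩ := bword_base hL hL' h
    by_cases hne : L = []
    · subst hne
      have : L' = [] := by simpa using e1.symm
      subst this
      exact Conn.refl _
    · have := e3 hne
      subst this
      have c1 := conn_canon f hL
      have c2 := conn_canon f hL'
      rw [← e1, ← e2] at c2
      exact c1.trans c2.symm

/-! #### Geodesics with different first letters -/

theorem exists_geo (M : ℕ) (u : List Letter) : ∃ v, Geo M v ∧ BEq M v u := by
  induction hn : u.length using Nat.strong_induction_on generalizing u with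
  | _ n ih =>
    by_cases hu : Geo M u
    · exact ⟨u, hu, BEq.refl M u⟩
    · unfold Geo at hu
      push Not at hu
      obtain ⟨v, hv, hlt⟩ := hu
      obtain ⟨w, hw, hwv⟩ := ih v.length (hn ▸ hlt) v rfl
      exact ⟨w, hw, hwv.trans hv⟩

theorem geo_name_ne_aux {M : ℕ} (hM : 2 ≤ M) {f : Bool} {u v : List Letter}
    (hu : Geo M ((f, true) :: u)) (hv : Geo M ((f, false) :: v)) :
    ¬ BEq M ((f, true) :: u) ((f, false) :: v) := by
  intro h
  unfold BEq at h
  rcases hu.cases hM with ⟨hp, -⟩ | ⟨-, hp⟩ | ⟨hp1, hp2, f', L, hL, e⟩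
  · rw [h] at hp
    have := (pos_cons.1 (hv.pos hM hp)).1
    simp at this
  · have := (pos_cons.1 hp).1
    simp at this
  · rw [h] at hp1 hp2
    obtain ⟨g', L', hL', e'⟩ := hv.mixed hM hp1 hp2
    obtain ⟨-, -, e3⟩ := bword_base hL hL' (by rw [← e, ← e']; exact h)
    have hne : L ≠ [] := by rintro rfl; simp [bword] at e
    have := e3 hne
    subst this
    have key : ∀ {g s : Bool} {u : List Letter} {L : List (Bool × ℕ)}, Proper M L →
        (g, s) :: u = bword M f' L → g = (f' ^^ !s) := by
      intro g s u L hL e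
      match L, hL with
      | [], _ => simp [bword] at e
      | (b, c) :: L, hL =>
        have h1 := (proper_cons.1 hL).1
        simp only at h1
        cases b
        · obtain ⟨n, hn⟩ : ∃ n, M - c = n + 1 := ⟨M - c - 1, by omega⟩
          rw [bword, hn, alt_succ] at e
          simp at e
          obtain ⟨⟨rfl, rfl⟩, -⟩ := e
          simp
        · obtain ⟨n, rfl⟩ : ∃ n, c = n + 1 := ⟨c - 1, by omega⟩
          rw [bword, alt_succ] at e
          simp at e
          obtain ⟨⟨rfl, rfl⟩, -⟩ := e
          simp
    have k1 := key hL e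
    have k2 := key hL' e'
    simp at k1 k2
    rw [k1] at k2
    simp at k2

theorem geo_name_ne {M : ℕ} (hM : 2 ≤ M) {a b : Letter} {u v : List Letter}
    (hu : Geo M (a :: u)) (hv : Geo M (b :: v)) (h : BEq M (a :: u) (b :: v)) (hab : a ≠ b) :
    b.1 = !a.1 := by
  by_contra hne
  obtain ⟨f, s⟩ := a
  obtain ⟨g, t⟩ := b
  have : g = f := by simp only at hne; cases f <;> cases g <;> simp_all
  subst this
  cases s <;> cases t
  · exact hab rfl
  · exact geo_name_ne_aux hM hv hu h.symm
  · exact geo_name_ne_aux hM hu hv h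
  · exact hab rfl

/-- A list splits as a power of `a` followed by a list not starting with `a`. -/
theorem exists_replicate (a : Letter) (u : List Letter) :
    ∃ k v, u = replicate k a ++ v ∧ ∀ b w, v = b :: w → b ≠ a := by
  induction u with
  | nil => exact ⟨0, [], rfl, by simp⟩
  | cons c u ih =>
    by_cases h : c = a
    · subst h
      obtain ⟨k, v, rfl, hv⟩ := ih
      exact ⟨k + 1, v, rfl, hv⟩
    · exact ⟨0, c :: u, rfl, by rintro b w ⟨⟩; exact h⟩

theorem Geo.no_inv_after {M : ℕ} (hM : 2 ≤ M) {a : Letter} {k : ℕ} {b : Letter}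
    {v : List Letter} (h : Geo M (a :: (replicate k a ++ b :: v))) (hb : b ≠ a) : b.1 = !a.1 := by
  have h1 : Geo M (a :: b :: v) := by
    have e : a :: (replicate k a ++ b :: v) = replicate k a ++ a :: b :: v := by
      rw [← cons_append, ← replicate_succ, replicate_succ', append_assoc]; rfl
    rw [e] at h
    exact h.drop
  by_contra hne
  have : b = (a.1, !a.2) := by
    obtain ⟨f, s⟩ := a
    obtain ⟨g, t⟩ := b
    simp only at hne
    cases f <;> cases g <;> cases s <;> cases t <;> simp_all
  rw [this] at h1
  exact h1.not_inv hM

theorem run_replicate {M : ℕ} (f : Bool) (k : ℕ) {c : ℕ} (cs : List ℕ) :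
    ∃ c' cs', run M (replicate k (f, true)) (ne f c cs 0) = ne f c' cs' 0 := by
  induction k with
  | zero => exact ⟨c, cs, rfl⟩
  | succ k ih =>
    obtain ⟨c', cs', h⟩ := ih
    rw [replicate_succ, run_cons, h]
    exact ⟨1, c' :: cs', by simp [act]⟩

/-- A positive word with normal form starting with `f` and `Δ`-free has no geodesic representative
starting with another name. -/
theorem not_beq_of_free {M : ℕ} (hM : 2 ≤ M) {f : Bool} {b : Letter} {v : List Letter} {c : ℕ}
    {cs : List ℕ} (hv : Geo M (b :: v)) (hb : b.1 = !f) :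
    run M (b :: v) (one 0) ≠ ne f c cs 0 := by
  intro h
  have hp := pos_cons.1 (hv.pos hM (by rw [h]; simp))
  obtain ⟨g, s⟩ := b
  simp only at hp hb
  obtain ⟨rfl, hp⟩ := hp
  have := hp.head_eq h
  rw [hb] at this
  simp at this

theorem flipW_replicate (k : ℕ) (a : Letter) :
    flipW (replicate k a) = replicate k (a.1, !a.2) := by simp [flipW]

theorem geo_first_switch {M : ℕ} (hM : 2 ≤ M) {a b : Letter} {u v : List Letter}
    (hu : Geo M (a :: u)) (hv : Geo M (b :: v)) (h : BEq M (a :: u) (b :: v)) (hab : a ≠ b) :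
    ∃ k b' w, u = replicate k a ++ b' :: w ∧ b'.1 = b.1 := by
  have hnb := geo_name_ne hM hu hv h hab
  obtain ⟨k, w, rfl, hw⟩ := exists_replicate a u
  match w, hw with
  | b' :: w, hw =>
    exact ⟨k, b', w, rfl, (hu.no_inv_after hM (hw b' w rfl)).trans hnb.symm⟩
  | [], _ =>
    exfalso
    rw [append_nil] at hu h
    have key : ∀ (f : Bool) {b : Letter} {v : List Letter}, Geo M (b :: v) →
        BEq M (replicate (k + 1) (f, true)) (b :: v) → b.1 = !f → False := by
      intro f b v hv h hb
      rw [replicate_succ'] at h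
      unfold BEq at h
      rw [run_append] at h
      obtain ⟨c', cs', e⟩ := run_replicate (M := M) f k (c := 1) []
      have : run M [(f, true)] (one 0) = ne f 1 [] 0 := rfl
      rw [this, e] at h
      exact not_beq_of_free hM hv hb h.symm
    obtain ⟨f, s⟩ := a
    rw [← replicate_succ] at h
    cases s
    · have h' := h.flip hM
      rw [flipW_replicate] at h'
      exact key f (hv.flip hM) h' hnb
    · exact key f hv h hnb

theorem geo_second_switch_aux {M : ℕ} (hM : 3 ≤ M) {f : Bool} {s : Bool} {k j : ℕ} {b : Letter}
    {v : List Letter}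
    (hu : Geo M (replicate (k + 1) (f, true) ++ replicate (j + 1) (!f, s))) (hv : Geo M (b :: v))
    (h : BEq M (replicate (k + 1) (f, true) ++ replicate (j + 1) (!f, s)) (b :: v))
    (hb : b.1 = !f) : False := by
  have hM2 : 2 ≤ M := by omega
  cases s
  · set L : List (Bool × ℕ) := replicate (k + 1) (true, 1) ++ replicate (j + 1) (false, M - 1)
      with hLdef
    have hL : Proper M L := by
      intro p hp
      simp only [hLdef, mem_append, mem_replicate] at hp
      rcases hp with ⟨-, rfl⟩ | ⟨-, rfl⟩ <;> simp <;> omega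
    have hw : replicate (k + 1) (f, true) ++ replicate (j + 1) (!f, false) = bword M f L := by
      have h1 : ∀ n, replicate n (!f, false) = bword M f (replicate n (false, M - 1)) := by
        intro n
        induction n with
        | zero => rfl
        | succ n ih =>
          have e : M - (M - 1) = 1 := by omega
          have e2 : (M + (M - 1) + 1).bodd = false := by
            have : M + (M - 1) + 1 = M + M := by omega
            rw [this]; simp
          rw [replicate_succ, ih, replicate_succ, bword, e, e2]
          simp [alt]
      have h2 : ∀ n, replicate n (f, true) ++ replicate (j + 1) (!f, false) =
          bword M f (replicate n (true, 1) ++ replicate (j + 1) (false, M - 1)) := by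
        intro n
        induction n with
        | zero => exact h1 _
        | succ n ih =>
          rw [replicate_succ, cons_append, ih, replicate_succ (n := n), cons_append, bword]
          simp [alt]
      exact h2 _
    have hneg : negs L = j + 1 := by
      simp [hLdef, negs, List.countP_replicate]
    have hlen : L.length = k + 1 + (j + 1) := by simp [hLdef]
    have hr := run_bword f hL 0
    rw [← hw] at hr
    unfold BEq at h
    rw [h] at hr
    obtain ⟨g, L', hL', e⟩ := hv.mixed hM2 (by rw [hr]; simp only [pow_mk]; omega)
      (by rw [hr]; simp only [pow_mk, blocks_mk, length_map]; omega)
    have hbb : BEq M (bword M f L) (bword M g L') := by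
      rw [← e, ← hw]; exact h
    obtain ⟨e1, e2, e3⟩ := bword_base hL hL' hbb
    have hgf : f = g := e3 (by intro h0; rw [h0] at hlen; simp at hlen)
    subst hgf
    have hlen2 := hu.length_eq hv h
    rw [e] at hlen2
    have hlen3 := congrArg List.length e1
    simp only [length_map, hlen] at hlen3
    match L', hL', e, e1 with
    | (t, c) :: L', hL', e, e1 =>
      have h1 := proper_cons.1 hL'
      have hc : c = 1 := by
        rw [hLdef, replicate_succ] at e1
        simp at e1
        exact e1.1.symm
      subst hc
      cases t
      · have h5 := bword_length_ge (f ^^ (M + 1 + 1).bodd) h1.2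
        simp [bword] at hlen2 hlen3 h5
        omega
      · simp [bword, alt] at e
        obtain ⟨rfl, -⟩ := e
        simp at hb
  · have h1 : ∃ c cs, run M (replicate j (!f, true)) (ne (!f) 1 [] 0) = ne (!f) c cs 0 ∧ c = 1 := by
      cases j with
      | zero => exact ⟨1, [], rfl, rfl⟩
      | succ j =>
        obtain ⟨c, cs, e⟩ := run_replicate (M := M) (!f) j (c := 1) []
        exact ⟨1, c :: cs, by rw [replicate_succ, run_cons, e]; simp [act], rfl⟩
    obtain ⟨c, cs, e, rfl⟩ := h1
    have h2 : run M (replicate (j + 1) (!f, true)) (one 0) = ne (!f) 1 cs 0 := by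
      rw [replicate_succ', run_append]; exact e
    have h3 : act M (f, true) (ne (!f) 1 cs 0) = ne f 2 cs 0 := by
      simp [act]; omega
    obtain ⟨c', cs', h4⟩ := run_replicate (M := M) f k (c := 2) cs
    unfold BEq at h
    rw [run_append, h2, replicate_succ', run_append, run_cons, run_nil, h3, h4] at h
    exact not_beq_of_free hM2 hv hb h.symm

theorem geo_second_switch {M : ℕ} (hM : 3 ≤ M) {a b : Letter} {u v : List Letter}
    (hu : Geo M (a :: u)) (hv : Geo M (b :: v)) (h : BEq M (a :: u) (b :: v)) (hab : a ≠ b) :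
    ∃ k b' j a' w, u = replicate k a ++ b' :: (replicate j b' ++ a' :: w) ∧ b'.1 = b.1 ∧
      a'.1 = a.1 := by
  have hM2 : 2 ≤ M := by omega
  have hnb := geo_name_ne hM2 hu hv h hab
  obtain ⟨k, b', w, rfl, hb'⟩ := geo_first_switch hM2 hu hv h hab
  obtain ⟨j, w, rfl, hw⟩ := exists_replicate b' w
  match w, hw with
  | a' :: w, hw =>
    have hg : Geo M (b' :: (replicate j b' ++ a' :: w)) := by
      rw [← cons_append] at hu
      exact hu.drop
    have := hg.no_inv_after hM2 (hw a' w rfl)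
    refine ⟨k, b', j, a', w, rfl, hb', ?_⟩
    rw [this, hb', hnb, Bool.not_not]
  | [], _ =>
    exfalso
    have e : a :: (replicate k a ++ b' :: (replicate j b' ++ [])) =
        replicate (k + 1) a ++ replicate (j + 1) b' := by
      rw [append_nil]; rfl
    rw [e] at hu h
    obtain ⟨f, s⟩ := a
    obtain ⟨g, t⟩ := b'
    simp only at hnb hb'
    rw [hb', hnb] at hu h
    cases s
    · have hu' := hu.flip hM2
      have h' := h.flip hM2
      rw [flipW_append, flipW_replicate, flipW_replicate] at hu' h'
      exact geo_second_switch_aux hM hu' (hv.flip hM2) h' hnb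
    · exact geo_second_switch_aux hM hu hv h hnb

/-! #### The commuting case -/

theorem beq_two_comm {a b : Letter} (h : b.1 = !a.1) (u : List Letter) :
    BEq 2 (a :: b :: u) (b :: a :: u) := by
  have : BEq 2 [a, b] [b, a] := by
    obtain ⟨f, s⟩ := a
    obtain ⟨g, t⟩ := b
    simp only at h
    subst h
    cases f <;> cases s <;> cases t <;> simp [BEq, act]
  exact this.append le_rfl (BEq.refl 2 u)

theorem beq_two_replicate {a b : Letter} (h : b.1 = !a.1) (k : ℕ) (u : List Letter) :
    BEq 2 (replicate k a ++ b :: u) (b :: (replicate k a ++ u)) := by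
  induction k with
  | zero => exact BEq.refl _ _
  | succ k ih => exact (ih.cons a).trans (beq_two_comm h _)

theorem geo_two {a b : Letter} {u v : List Letter} (hu : Geo 2 (a :: u)) (hv : Geo 2 (b :: v))
    (h : BEq 2 (a :: u) (b :: v)) (hab : a ≠ b) :
    ∃ w, BEq 2 u (b :: w) ∧ BEq 2 v (a :: w) ∧ w.length + 1 = u.length := by
  have hnb := geo_name_ne le_rfl hu hv h hab
  obtain ⟨k, b', w, rfl, hb'⟩ := geo_first_switch le_rfl hu hv h hab
  have hb'a : b'.1 = !a.1 := hb'.trans hnb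
  have h1 := beq_two_replicate hb'a k w
  have h2 : BEq 2 (a :: (replicate k a ++ b' :: w)) (b' :: (replicate (k + 1) a ++ w)) :=
    beq_two_replicate hb'a (k + 1) w
  have hbb : b' = b := by
    by_contra hne
    have hg := hu.of_beq h2 (by simp; omega)
    have := geo_name_ne le_rfl hg hv (h2.symm.trans h) hne
    rw [hb'] at this
    simp at this
  subst hbb
  exact ⟨replicate k a ++ w, h1, (h.symm.trans h2).of_cons le_rfl, by simp; omega⟩

/-! #### Exchanging the names -/

/-- Exchange the two names. -/
def swapW (u : List Letter) : List Letter := u.map fun l => (!l.1, l.2)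

@[simp] theorem swapW_nil : swapW [] = [] := rfl

@[simp] theorem swapW_cons (l : Letter) (u : List Letter) :
    swapW (l :: u) = (!l.1, l.2) :: swapW u := rfl

@[simp] theorem swapW_swapW (u : List Letter) : swapW (swapW u) = u := by
  simp [swapW, Function.comp_def]

@[simp] theorem length_swapW (u : List Letter) : (swapW u).length = u.length := by simp [swapW]

/-- Exchange the two names in a normal form. -/
def swapE : Elt → Elt
  | one k => one k
  | ne f c cs k => ne (!f) c cs k

theorem run_swapW (M : ℕ) (u : List Letter) : run M (swapW u) (one 0) = swapE (run M u (one 0)) := by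
  induction u with
  | nil => rfl
  | cons l u ih =>
    rw [swapW_cons, run_cons, ih, run_cons]
    generalize run M u (one 0) = x
    obtain ⟨g, b⟩ := l
    cases x with
    | one k => cases b <;> simp [act, swapE]
    | ne f c cs k =>
      have hmk : ∀ (k : ℤ), mk (!f) cs k = swapE (mk f cs k) := by
        intro k; cases cs <;> rfl
      cases b
      · simp only [act, swapE, Bool.not_inj_iff, Bool.not_not, hmk]
        split_ifs <;> simp
      · simp only [act, swapE, Bool.not_inj_iff, hmk]
        split_ifs <;> simp

theorem BEq.swap {M : ℕ} {u v : List Letter} (h : BEq M u v) : BEq M (swapW u) (swapW v) := by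
  unfold BEq at *
  rw [run_swapW, run_swapW, h]

theorem Geo.swap {M : ℕ} {u : List Letter} (h : Geo M u) : Geo M (swapW u) := by
  intro v hv
  have := hv.swap
  rw [swapW_swapW] at this
  simpa using h _ this

end Dihedral

section

open Dihedral

/-! ### Words over a pair of generators -/

/-- The letter over `{s, t}` given by a dihedral letter. -/
def embLetter (s t : S) (l : Letter) : S × Bool := (if l.1 then s else t, l.2)

/-- The word over `{s, t}` given by a dihedral word. -/
def emb (s t : S) (u : List Letter) : Word S := u.map (embLetter s t)

@[simp] theorem emb_nil (s t : S) : emb s t [] = [] := rfl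

@[simp] theorem emb_cons (s t : S) (l : Letter) (u : List Letter) :
    emb s t (l :: u) = embLetter s t l :: emb s t u := rfl

@[simp] theorem emb_append (s t : S) (u v : List Letter) :
    emb s t (u ++ v) = emb s t u ++ emb s t v := by simp [emb]

@[simp] theorem length_emb (s t : S) (u : List Letter) : (emb s t u).length = u.length := by
  simp [emb]

@[simp] theorem emb_replicate (s t : S) (k : ℕ) (l : Letter) :
    emb s t (replicate k l) = replicate k (embLetter s t l) := by simp [emb]

theorem embLetter_true (s t : S) (p : Bool) : embLetter s t (true, p) = (s, p) := rfl

theorem embLetter_false (s t : S) (p : Bool) : embLetter s t (false, p) = (t, p) := rfl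

theorem embLetter_swap (s t : S) (l : Letter) : embLetter s t (!l.1, l.2) = embLetter t s l := by
  obtain ⟨f, p⟩ := l
  cases f <;> rfl

theorem emb_swapW (s t : S) (u : List Letter) : emb s t (swapW u) = emb t s u := by
  induction u with
  | nil => rfl
  | cons l u ih => rw [swapW_cons, emb_cons, emb_cons, ih, embLetter_swap]

theorem embLetter_fst_inj {s t : S} (hst : s ≠ t) {l l' : Letter}
    (h : (embLetter s t l).1 = (embLetter s t l').1) : l.1 = l'.1 := by
  obtain ⟨f, p⟩ := l
  obtain ⟨g, q⟩ := l'
  cases f <;> cases g <;> simp_all [embLetter]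

theorem embLetter_injective {s t : S} (hst : s ≠ t) {l l' : Letter}
    (h : embLetter s t l = embLetter s t l') : l = l' :=
  Prod.ext (embLetter_fst_inj hst (congrArg Prod.fst h)) (congrArg Prod.snd h :)

/-! ### Equality of words up to length-preserving dihedral moves -/

/-- Two geodesic dihedral words with equal values, starting with the letters `(true, p)` and
`(false, q)`, given by their tails. -/
structure TauPair (M : ℕ) (p q : Bool) (D D' : List Letter) : Prop where
  left : Geo M ((true, p) :: D)
  right : Geo M ((false, q) :: D')
  beq : BEq M ((true, p) :: D) ((false, q) :: D')

theorem TauPair.swap {M : ℕ} {p q : Bool} {D D' : List Letter} (h : TauPair M p q D D') :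
    TauPair M q p (swapW D') (swapW D) :=
  ⟨h.right.swap, h.left.swap, h.beq.symm.swap⟩

theorem TauPair.length_eq {M : ℕ} {p q : Bool} {D D' : List Letter} (h : TauPair M p q D D') :
    D.length = D'.length := by
  simpa using h.left.length_eq h.right h.beq

/-- Equality of words up to recursive replacement of a head letter through a geodesic dihedral
word which starts with this letter. -/
inductive TEq (A : ArtinData S) : Word S → Word S → Prop
  | nil : TEq A [] []
  | cons (a : S × Bool) {x y : Word S} : TEq A x y → TEq A (a :: x) (a :: y)
  | tau {s t : S} {M : ℕ} {p q : Bool} {D D' : List Letter} {x y z : Word S} : s ≠ t →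
      A.m s t = M → TauPair M p q D D' → TEq A x (emb s t D ++ z) → TEq A y (emb s t D' ++ z) →
      TEq A ((s, p) :: x) ((t, q) :: y)

section

variable {A : ArtinData S}

theorem ArtinData.two_le_nat {s t : S} {M : ℕ} (hst : s ≠ t) (hM : A.m s t = M) : 2 ≤ M := by
  have := A.two_le s t hst
  rw [hM] at this
  exact_mod_cast this

theorem TEq.refl (u : Word S) : TEq A u u := by
  induction u with
  | nil => exact .nil
  | cons a u ih => exact .cons a ih

theorem TEq.symm {u v : Word S} (h : TEq A u v) : TEq A v u := by
  induction h with
  | nil => exact .nil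
  | cons a _ ih => exact .cons a ih
  | @tau s t M p q D D' x y z hst hM hp h1 h2 ih1 ih2 =>
    refine .tau (z := z) hst.symm ((A.symm t s).trans hM) hp.swap ?_ ?_
    · rwa [emb_swapW]
    · rwa [emb_swapW]

theorem TEq.length_eq {u v : Word S} (h : TEq A u v) : u.length = v.length := by
  induction h with
  | nil => rfl
  | cons a _ ih => simp [ih]
  | tau hst hM hp h1 h2 ih1 ih2 =>
    have := hp.length_eq
    simp only [List.length_append, length_emb, List.length_cons] at *
    omega

theorem TEq.append_left (u : Word S) {x y : Word S} (h : TEq A x y) : TEq A (u ++ x) (u ++ y) := by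
  induction u with
  | nil => exact h
  | cons a u ih => exact .cons a ih

theorem TEq.cons_cases {a b : S × Bool} {x y : Word S} (h : TEq A (a :: x) (b :: y)) :
    (a = b ∧ TEq A x y) ∨ (a.1 ≠ b.1 ∧ ∃ (M : ℕ) (D D' : List Letter) (z : Word S),
      A.m a.1 b.1 = M ∧ TauPair M a.2 b.2 D D' ∧ TEq A x (emb a.1 b.1 D ++ z) ∧
        TEq A y (emb a.1 b.1 D' ++ z)) := by
  cases h with
  | cons _ h => exact .inl ⟨rfl, h⟩
  | tau hst hM hp h1 h2 => exact .inr ⟨hst, _, _, _, _, hM, hp, h1, h2⟩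

theorem TEq.of_cons {a b : S × Bool} {x y : Word S} (h : TEq A (a :: x) (b :: y))
    (hab : a.1 = b.1) : a = b ∧ TEq A x y :=
  h.cons_cases.resolve_right fun h' => h'.1 hab

theorem TEq.of_replicate {k : ℕ} {a : S × Bool} {x y : Word S}
    (h : TEq A (replicate k a ++ x) (replicate k a ++ y)) : TEq A x y := by
  induction k with
  | zero => exact h
  | succ k ih => exact ih (h.of_cons rfl).2

/-- The tau rule for arbitrary distinct letters over `{s, t}`. -/
theorem TEq.tau_intro {s t : S} {M : ℕ} (hst : s ≠ t) (hM : A.m s t = M) {α β : Letter}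
    {D D' : List Letter} {x y z : Word S} (hD : Geo M (α :: D)) (hD' : Geo M (β :: D'))
    (h : BEq M (α :: D) (β :: D')) (hαβ : α ≠ β) (hx : TEq A x (emb s t D ++ z))
    (hy : TEq A y (emb s t D' ++ z)) : TEq A (embLetter s t α :: x) (embLetter s t β :: y) := by
  have hn := geo_name_ne (A.two_le_nat hst hM) hD hD' h hαβ
  obtain ⟨f, p⟩ := α
  obtain ⟨g, q⟩ := β
  cases f
  · obtain rfl : g = true := by simpa using hn
    exact (TEq.tau hst hM ⟨hD', hD, h.symm⟩ hy hx).symm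
  · obtain rfl : g = false := by simpa using hn
    exact TEq.tau hst hM ⟨hD, hD', h⟩ hx hy

theorem TEq.of_beq {s t : S} {M : ℕ} (hst : s ≠ t) (hM : A.m s t = M) {D D' : List Letter}
    (hD : Geo M D) (hD' : Geo M D') (h : BEq M D D') (z : Word S) :
    TEq A (emb s t D ++ z) (emb s t D' ++ z) := by
  have h2 := A.two_le_nat hst hM
  induction D generalizing D' with
  | nil =>
    have := hD.length_eq hD' h
    cases D' with
    | nil => exact .refl _
    | cons => simp at this
  | cons α D ih =>
    cases D' with
    | nil => simpa using hD.length_eq hD' h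
    | cons β D' =>
      by_cases hαβ : α = β
      · subst hαβ
        exact .cons _ (ih hD.tail hD'.tail (h.of_cons h2))
      · exact TEq.tau_intro hst hM hD hD' h hαβ (.refl _) (.refl _)

/-- Analysis of an equality between words starting with letters over `{s, t}`. -/
theorem TEq.emb_cases {s t : S} {M : ℕ} (hst : s ≠ t) (hM : A.m s t = M) {α β : Letter}
    {x y : Word S} (h : TEq A (embLetter s t α :: x) (embLetter s t β :: y)) :
    (α = β ∧ TEq A x y) ∨ ∃ (D D' : List Letter) (z : Word S), BEq M (α :: D) (β :: D') ∧
      TEq A x (emb s t D ++ z) ∧ TEq A y (emb s t D' ++ z) := by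
  rcases h.cons_cases with ⟨h1, h2⟩ | ⟨hne, M', D, D', z, hM', hp, h1, h2⟩
  · exact .inl ⟨embLetter_injective hst h1, h2⟩
  · right
    obtain ⟨f, p⟩ := α
    obtain ⟨g, q⟩ := β
    cases f <;> cases g <;> simp only [embLetter] at *
    · exact absurd rfl hne
    · have : A.m t s = M' := hM'
      obtain rfl : M' = M := by
        rw [A.symm, hM] at this
        exact_mod_cast this.symm
      refine ⟨swapW D, swapW D', z, hp.beq.swap, ?_, ?_⟩
      · rw [emb_swapW]; exact h1
      · rw [emb_swapW]; exact h2
    · have : A.m s t = M' := hM'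
      obtain rfl : M' = M := by
        rw [hM] at this
        exact_mod_cast this.symm
      exact ⟨D, D', z, hp.beq, h1, h2⟩
    · exact absurd rfl hne

/-! ### Reduced words -/

/-- A word is reduced when no letter can be cancelled against the following suffix. -/
inductive Red (A : ArtinData S) : Word S → Prop
  | nil : Red A []
  | cons {a : S × Bool} {x : Word S} : Red A x → (∀ y, ¬ TEq A x ((a.1, !a.2) :: y)) →
      Red A (a :: x)

theorem Red.tail {a : S × Bool} {x : Word S} (h : Red A (a :: x)) : Red A x := by
  cases h with
  | cons h _ => exact h

theorem Red.not_teq {a : S × Bool} {x : Word S} (h : Red A (a :: x)) (y : Word S) :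
    ¬ TEq A x ((a.1, !a.2) :: y) := by
  cases h with
  | cons _ h => exact h y

theorem Red.of_append {u x : Word S} (h : Red A (u ++ x)) : Red A x := by
  induction u with
  | nil => exact h
  | cons a u ih => exact ih h.tail

theorem Red.exists_of_not_cons {a : S × Bool} {x : Word S} (hx : Red A x) (h : ¬ Red A (a :: x)) :
    ∃ y, TEq A x ((a.1, !a.2) :: y) := by
  by_contra hne
  push Not at hne
  exact h (.cons hx hne)

theorem Red.geo {s t : S} {M : ℕ} (hst : s ≠ t) (hM : A.m s t = M) {D : List Letter} {z : Word S}
    (h : Red A (emb s t D ++ z)) : Geo M D := by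
  have h2 := A.two_le_nat hst hM
  induction D with
  | nil => intro v _; simp
  | cons γ D ih =>
    have hD := ih h.tail
    by_contra hc
    obtain ⟨k, hk, hg⟩ := hD.exists_of_not_cons h2 hc
    exact h.not_teq (emb s t k ++ z) (TEq.of_beq hst hM hD hg hk z)

/-- Transitivity at reduced words of bounded length. -/
def TransUpTo (A : ArtinData S) (n : ℕ) : Prop :=
  ∀ u v w : Word S, u.length ≤ n → Red A v → TEq A u v → TEq A v w → TEq A u w

/-- Closure of the reduced words of bounded length. -/
def ClosUpTo (A : ArtinData S) (n : ℕ) : Prop :=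
  ∀ u v : Word S, u.length ≤ n → Red A u → TEq A u v → Red A v

variable {n : ℕ}

/-- The tails of two equal words with prefixes over `{s, t}` have further such prefixes. -/
theorem TEq.merge (hT : TransUpTo A n) (hC : ClosUpTo A n) {s t : S} {M : ℕ} (hst : s ≠ t)
    (hM : A.m s t = M) {D D' : List Letter} {z z' : Word S} (hN : D.length + z.length ≤ n + 1)
    (hw : Red A (emb s t D ++ z)) (hw' : Red A (emb s t D' ++ z'))
    (h : TEq A (emb s t D ++ z) (emb s t D' ++ z')) :
    ∃ (I J : List Letter) (q : Word S), TEq A z (emb s t I ++ q) ∧ TEq A z' (emb s t J ++ q) ∧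
      BEq M (D ++ I) (D' ++ J) := by
  have h2 := A.two_le_nat hst hM
  induction hk : D.length + z.length using Nat.strong_induction_on generalizing D D' z z' with
  | _ k ih =>
  subst hk
  match D, D' with
  | [], D' => exact ⟨D', [], z', h, .refl _, by simpa using Dihedral.BEq.refl M D'⟩
  | D, [] => exact ⟨[], D, z, .refl _, h.symm, by simpa using Dihedral.BEq.refl M D⟩
  | α :: D, β :: D' =>
    have hlen := h.length_eq
    simp only [emb_cons, List.cons_append, List.length_cons, List.length_append, length_emb]
      at hlen hN ih
    rcases TEq.emb_cases (x := emb s t D ++ z) (y := emb s t D' ++ z') hst hM h with ⟨rfl, h0⟩ | ⟨F, F', y, hb, h1, h1'⟩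
    · obtain ⟨I, J, q, hz, hz', hIJ⟩ := ih _ (by omega) (by omega) hw.tail hw'.tail h0 rfl
      exact ⟨I, J, q, hz, hz', hIJ.cons α⟩
    · have l1 := h1.length_eq
      have l1' := h1'.length_eq
      simp only [List.length_append, length_emb] at l1 l1'
      have w1 : Red A (emb s t F ++ y) := hC _ _ (by simp; omega) hw.tail h1
      have w1' : Red A (emb s t F' ++ y) := hC _ _ (by simp; omega) hw'.tail h1'
      obtain ⟨I₁, J₁, q₁, hz, hy, e₁⟩ := ih _ (by omega) (by omega) hw.tail w1 h1 rfl
      obtain ⟨I₂, J₂, q₂, hz', hy', e₂⟩ := ih _ (by omega) (by omega) hw'.tail w1' h1' rfl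
      have wy : Red A y := w1.of_append
      have ly : y.length = J₁.length + q₁.length := by simpa using hy.length_eq
      have wJ₁ := hC _ _ (by omega) wy hy
      have wJ₂ := hC _ _ (by omega) wy hy'
      have hJ := hT _ _ _ (by simp; omega) wy hy.symm hy'
      obtain ⟨I₃, J₃, q₃, hq, hq', e₃⟩ := ih _ (by omega) (by omega) wJ₁ wJ₂ hJ rfl
      have wz : Red A z := hw.of_append (u := emb s t (α :: D))
      have wz' : Red A z' := hw'.of_append (u := emb s t (β :: D'))
      refine ⟨I₁ ++ I₃, I₂ ++ J₃, q₃, ?_, ?_, ?_⟩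
      · rw [emb_append, List.append_assoc]
        exact hT _ _ _ (by omega) (hC _ _ (by omega) wz hz) hz (hq.append_left _)
      · rw [emb_append, List.append_assoc]
        exact hT _ _ _ (by omega) (hC _ _ (by omega) wz' hz') hz' (hq'.append_left _)
      · have k1 : BEq M (α :: D ++ (I₁ ++ I₃)) (α :: F ++ (J₁ ++ I₃)) := by
          simpa using ((e₁.append h2 (Dihedral.BEq.refl M I₃)).cons α)
        have k2 : BEq M (β :: D' ++ (I₂ ++ J₃)) (β :: F' ++ (J₂ ++ J₃)) := by
          simpa using ((e₂.append h2 (Dihedral.BEq.refl M J₃)).cons β)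
        exact (k1.trans (hb.append h2 e₃)).trans k2.symm

end

section

variable {A : ArtinData S} {n : ℕ}

theorem Red.cons_of_teq (hT : TransUpTo A n) (hC : ClosUpTo A n) {a : S × Bool} {x y : Word S}
    (hx : x.length ≤ n) (h : Red A (a :: x)) (hxy : TEq A x y) : Red A (a :: y) := by
  have wy := hC _ _ hx h.tail hxy
  exact .cons wy fun k hk => h.not_teq k (hT _ _ _ hx wy hxy hk)

theorem Red.of_teq_succ (hT : TransUpTo A n) (hC : ClosUpTo A n) : ClosUpTo A (n + 1) := by
  intro u v hu wu h
  cases h with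
  | nil => exact .nil
  | cons a h => exact wu.cons_of_teq hT hC (by simpa using hu) h
  | @tau s t M p q D D' x y z hst hM hp h1 h2 =>
    have hM2 := A.two_le_nat hst hM
    have hx : x.length ≤ n := by simpa using hu
    have l1 : x.length = D.length + z.length := by simpa using h1.length_eq
    have l2 : y.length = D'.length + z.length := by simpa using h2.length_eq
    have lD := hp.length_eq
    have wD : Red A (emb s t D ++ z) := hC _ _ hx wu.tail h1
    have wz : Red A z := wD.of_append
    have key : ∀ P G, ((false, q) :: D' : List Letter) = P ++ G → Red A (emb s t G ++ z) := by
      intro P G hG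
      induction G generalizing P with
      | nil => exact wz
      | cons γ G ih =>
        have wG := ih (P ++ [γ]) (by simpa using hG)
        have lG : D'.length + 1 = P.length + (G.length + 1) := by
          simpa using congrArg List.length hG
        refine .cons wG fun k hk => ?_
        have lk : G.length + z.length = k.length + 1 := by simpa using hk.length_eq
        have wk : Red A (emb s t [(γ.1, !γ.2)] ++ k) := hC _ _ (by simp; omega) wG hk
        obtain ⟨I, J, r, hz, hk', e⟩ := TEq.merge hT hC hst hM (by omega) wG wk hk
        have lz : z.length = I.length + r.length := by simpa using hz.length_eq
        have lJ : k.length = J.length + r.length := by simpa using hk'.length_eq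
        have e1 : Dihedral.BEq M (γ :: G ++ I) J := (e.cons γ).trans (beq_cancel hM2 γ J)
        have e2 : Dihedral.BEq M ((true, p) :: D ++ I) (P ++ J) := by
          refine (hp.beq.append hM2 (Dihedral.BEq.refl M I)).trans ?_
          rw [hG, List.append_assoc]
          exact (Dihedral.BEq.refl M P).append hM2 e1
        have h3 : TEq A x (emb s t (D ++ I) ++ r) := by
          rw [emb_append, List.append_assoc]
          exact hT _ _ _ hx wD h1 (hz.append_left _)
        have w3 : Red A (emb s t ((true, p) :: D ++ I) ++ r) := wu.cons_of_teq hT hC hx h3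
        have := w3.geo hst hM _ e2.symm
        simp only [List.length_append, List.length_cons] at this
        omega
    have w4 : Red A ((t, q) :: (emb s t D' ++ z)) := key [] _ rfl
    exact w4.cons_of_teq hT hC (by simp; omega) h2.symm

/-- Three generators with finite labels which do not pairwise commute cannot share a reduced word
in which one of them can be exchanged with both of the others. -/
theorem Red.no_triangle (hsuff : ∀ s t u : S, s ≠ t → s ≠ u → t ≠ u →
      A.m s t = 2 → A.m s u ≠ 2 → A.m s u ≠ ⊤ → A.m t u = ⊤)
    (hT : TransUpTo A n) (hC : ClosUpTo A n) {s t r : S} (hst : s ≠ t) (hsr : s ≠ r) (htr : t ≠ r)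
    (h2 : ¬ (A.m s t = 2 ∧ A.m s r = 2 ∧ A.m t r = 2)) {y : Word S} (hy : y.length ≤ n)
    (wy : Red A y) {M : ℕ} (hM : A.m s t = M) {p q : Bool} {D D' : List Letter}
    (hp : TauPair M p q D D') {z : Word S} (hD : TEq A y (emb s t D ++ z)) {l : ℕ} {c : Bool}
    {z' : Word S} (hsrM : A.m s r ≠ ⊤) (hc : TEq A y (replicate l (s, p) ++ (r, c) :: z')) :
    False := by
  induction hk : y.length using Nat.strong_induction_on
    generalizing s t r y M p q D D' z l c z' with
  | _ N ih =>
  subst hk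
  have hM2 := A.two_le_nat hst hM
  obtain ⟨k, b', w, hDk, hb', hw⟩ : ∃ k b' w, D = replicate k (true, p) ++ b' :: w ∧ b'.1 = false ∧
      (3 ≤ M → ∃ j a' w', w = replicate j b' ++ a' :: w' ∧ a'.1 = true) := by
    by_cases h3 : 3 ≤ M
    · obtain ⟨k, b', j, a', w, e, hb, ha⟩ :=
        geo_second_switch h3 hp.left hp.right hp.beq (by simp)
      exact ⟨k, b', _, e, hb, fun _ => ⟨j, a', w, rfl, ha⟩⟩
    · obtain ⟨k, b', w, e, hb⟩ := geo_first_switch hM2 hp.left hp.right hp.beq (by simp)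
      exact ⟨k, b', w, e, hb, fun h => absurd h h3⟩
  obtain ⟨f, e⟩ := b'
  obtain rfl : f = false := hb'
  have hE : emb s t D ++ z = replicate k (s, p) ++ (t, e) :: (emb s t w ++ z) := by
    simp [hDk, embLetter]
  rw [hE] at hD
  have w1 := hC _ _ hy wy hD
  have w2 := hC _ _ hy wy hc
  have l1 : y.length = k + (w.length + z.length + 1) := by simpa using hD.length_eq
  have l2 : y.length = l + (z'.length + 1) := by simpa using hc.length_eq
  have h := hT _ _ _ (hD.length_eq ▸ hy) wy hD.symm hc
  rcases lt_trichotomy k l with hkl | rfl | hkl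
  · obtain ⟨d, rfl⟩ : ∃ d, l = k + (d + 1) := ⟨l - k - 1, by omega⟩
    rw [replicate_add, List.append_assoc] at h w2
    have h := h.of_replicate
    have w2 := w2.of_append.tail
    rcases h.symm.cons_cases with ⟨h', -⟩ | ⟨-, M', F, F', z₂, hM', hp', h1, -⟩
    · exact hst (congrArg Prod.fst h')
    · refine ih _ ?_ hst hsr htr h2 ?_ w2 hM' hp' h1 hsrM (.refl _) rfl
      all_goals simp; omega
  · rcases h.of_replicate.cons_cases with ⟨h', -⟩ | ⟨-, M', F, F', z₂, hM', hp', h1, -⟩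
    · exact htr (congrArg Prod.fst h')
    · have htrM : A.m t r ≠ ⊤ := by
        have : A.m t r = M' := hM'
        rw [this]; exact ENat.natCast_ne_top _
      have hstM : A.m s t ≠ ⊤ := by rw [hM]; exact ENat.natCast_ne_top _
      have hM3 : 3 ≤ M := by
        rcases hM2.lt_or_eq with h | h
        · exact h
        · have hst2 : A.m s t = 2 := by rw [hM, ← h]; rfl
          have a1 : A.m s r = 2 := by
            by_contra hne
            exact htrM (hsuff s t r hst hsr htr hst2 hne hsrM)
          have a2 : A.m t r = 2 := by
            by_contra hne
            exact hsrM (hsuff t s r hst.symm htr hsr (A.symm t s ▸ hst2) hne htrM)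
          exact absurd ⟨hst2, a1, a2⟩ h2
      obtain ⟨j, ⟨f, a⟩, w', rfl, ha⟩ := hw hM3
      obtain rfl : f = true := ha
      have w1 := w1.of_append.tail
      refine ih _ ?_ htr hst.symm hsr.symm ?_ ?_ w1 hM' hp' h1 (A.symm s t ▸ hstM) (l := j)
        (c := a) (z' := emb s t w' ++ z) ?_ rfl
      · simp at l1 ⊢; omega
      · rw [A.symm t s, A.symm r s]; tauto
      · simp at l1 ⊢; omega
      · convert TEq.refl _ using 1
        simp [embLetter]
  · obtain ⟨d, rfl⟩ : ∃ d, k = l + (d + 1) := ⟨k - l - 1, by omega⟩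
    rw [replicate_add, List.append_assoc] at h w1
    have h := h.of_replicate
    have w1 := w1.of_append.tail
    rcases h.cons_cases with ⟨h', -⟩ | ⟨-, M', F, F', z₂, hM', hp', h1, -⟩
    · exact hsr (congrArg Prod.fst h')
    · refine ih _ ?_ hsr hst htr.symm ?_ ?_ w1 hM' hp' h1 (hM ▸ ENat.natCast_ne_top _) (.refl _) rfl
      · simp; omega
      · rw [A.symm r t]; tauto
      · simp; omega

theorem tauPair_two (p q : Bool) : TauPair 2 p q [(false, q)] [(true, p)] := by
  have hgeo : ∀ α β : Letter, β.1 = !α.1 → Geo 2 [α, β] := by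
    rintro ⟨f, p⟩ ⟨g, q⟩ rfl u hu
    have := hu.length_parity le_rfl
    match u, this with
    | [], _ => cases f <;> cases p <;> cases q <;> simp [Dihedral.BEq, act] at hu
    | [_], h => simp at h
    | _ :: _ :: _, _ => simp
  exact ⟨hgeo _ _ rfl, hgeo _ _ rfl, beq_two_comm rfl []⟩

theorem TEq.comm {s t : S} (hst : s ≠ t) (h : A.m s t = 2) (p q : Bool) (v : Word S) :
    TEq A ((s, p) :: (t, q) :: v) ((t, q) :: (s, p) :: v) :=
  .tau hst h (tauPair_two p q) (.refl _) (.refl _)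

theorem TEq.exists_of_two (hT : TransUpTo A n) (hC : ClosUpTo A n) {a b : S × Bool} {x y : Word S}
    (hx : x.length ≤ n) (wx : Red A x) (wy : Red A y) (h : TEq A (a :: x) (b :: y))
    (hab : a.1 ≠ b.1) (h2 : A.m a.1 b.1 = 2) :
    ∃ w, TEq A x (b :: w) ∧ TEq A y (a :: w) := by
  have hy : y.length ≤ n := by
    have := h.length_eq
    simp only [List.length_cons] at this
    omega
  rcases h.cons_cases with ⟨rfl, -⟩ | ⟨-, M, D, D', z, hM, hp, h1, h1'⟩
  · exact absurd rfl hab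
  · obtain rfl : M = 2 := by
      rw [h2] at hM
      exact_mod_cast hM.symm
    have lD := hp.length_eq
    obtain ⟨w, e1, e2, lw⟩ := geo_two hp.left hp.right hp.beq (by simp)
    refine ⟨emb a.1 b.1 w ++ z, ?_, ?_⟩
    · exact hT _ _ _ hx (hC _ _ hx wx h1) h1
        (TEq.of_beq hab h2 hp.left.tail (hp.left.tail.of_beq e1 (by simp; omega)) e1 z)
    · exact hT _ _ _ hy (hC _ _ hy wy h1') h1'
        (TEq.of_beq hab h2 hp.right.tail (hp.right.tail.of_beq e2 (by simp; omega)) e2 z)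

end

section

variable {A : ArtinData S} {n : ℕ}

theorem TEq.trans_of_fst_eq (hT : TransUpTo A n) (hC : ClosUpTo A n) {a b c : S × Bool}
    {x y x' : Word S} (hx : x.length ≤ n) (hab : a.1 ≠ b.1) (hac : a.1 = c.1)
    (wu : Red A (a :: x)) (wv : Red A (b :: y)) (ww : Red A (c :: x'))
    (h : TEq A (a :: x) (b :: y)) (h' : TEq A (c :: x') (b :: y)) :
    TEq A (a :: x) (c :: x') := by
  obtain ⟨s, p⟩ := a
  obtain ⟨s', p'⟩ := c
  obtain rfl : s = s' := hac
  have l1 := h.length_eq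
  have l2 := h'.length_eq
  simp only [List.length_cons] at l1 l2
  rcases h.cons_cases with ⟨e, -⟩ | ⟨-, M, D, D', z, hM, hp, h1, h1'⟩
  · exact absurd (congrArg Prod.fst e) hab
  rcases h'.cons_cases with ⟨e, -⟩ | ⟨-, M', F, F', z', hM', hp', h2, h2'⟩
  · exact absurd (congrArg Prod.fst e) hab
  obtain rfl : M' = M := by
    have : (M' : ℕ∞) = M := hM'.symm.trans hM
    exact_mod_cast this
  have hM2 := A.two_le_nat hab hM
  have wD' := hC _ _ (by omega) wv.tail h1'
  have wF' := hC _ _ (by omega) wv.tail h2'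
  have k1 : y.length = D'.length + z.length := by simpa using h1'.length_eq
  have hDF := hT _ _ _ (h1'.length_eq ▸ (by omega)) wv.tail h1'.symm h2'
  obtain ⟨I, J, q, hz, hz', e⟩ := TEq.merge hT hC hab hM (by omega) wD' wF' hDF
  have wD := hC _ _ hx wu.tail h1
  have wF := hC _ _ (by omega) ww.tail h2
  have g1 : TEq A x (emb s b.1 (D ++ I) ++ q) := by
    rw [emb_append, List.append_assoc]
    exact hT _ _ _ hx wD h1 (hz.append_left _)
  have g2 : TEq A x' (emb s b.1 (F ++ J) ++ q) := by
    rw [emb_append, List.append_assoc]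
    exact hT _ _ _ (by omega) wF h2 (hz'.append_left _)
  have w1 : Red A (emb s b.1 ((true, p) :: (D ++ I)) ++ q) := wu.cons_of_teq hT hC hx g1
  have w2 : Red A (emb s b.1 ((true, p') :: (F ++ J)) ++ q) :=
    ww.cons_of_teq hT hC (by omega) g2
  have hbeq : Dihedral.BEq M' ((true, p) :: (D ++ I)) ((true, p') :: (F ++ J)) :=
    ((hp.beq.append hM2 (Dihedral.BEq.refl M' I)).trans (e.cons _)).trans
      (hp'.beq.append hM2 (Dihedral.BEq.refl M' J)).symm
  have geo1 := w1.geo hab hM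
  have geo2 := w2.geo hab hM
  by_cases hpp : p = p'
  · subst hpp
    have g3 := TEq.of_beq hab hM geo1.tail geo2.tail (hbeq.of_cons hM2) q
    exact .cons _ (hT _ _ _ hx w1.tail g1 (hT _ _ _ (g1.length_eq ▸ hx) w2.tail g3 g2.symm))
  · simpa using geo_name_ne hM2 geo1 geo2 hbeq (by simpa using hpp)

theorem TEq.trans_of_two (hT : TransUpTo A n) (hC : ClosUpTo A n) {a b c : S × Bool}
    {x y x' : Word S} (hx : x.length ≤ n) (hab : a.1 ≠ b.1) (hbc : b.1 ≠ c.1) (hac : a.1 ≠ c.1)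
    (hab2 : A.m a.1 b.1 = 2) (hbc2 : A.m b.1 c.1 = 2) (hac2 : A.m a.1 c.1 = 2)
    (wx : Red A x) (wy : Red A y) (wx' : Red A x')
    (h : TEq A (a :: x) (b :: y)) (h' : TEq A (b :: y) (c :: x')) :
    TEq A (a :: x) (c :: x') := by
  have l1 := h.length_eq
  have l2 := h'.length_eq
  simp only [List.length_cons] at l1 l2
  obtain ⟨w, e1, e2⟩ := h.exists_of_two hT hC hx wx wy hab hab2
  obtain ⟨w', e3, e4⟩ := h'.exists_of_two hT hC (by omega) wy wx' hbc hbc2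
  have f1 := hC _ _ hx wx e1
  have f2 := hC _ _ (by omega) wy e2
  have f3 := hC _ _ (by omega) wy e3
  have f4 := hC _ _ (by omega) wx' e4
  have lw := e1.length_eq
  have lw' := e4.length_eq
  simp only [List.length_cons] at lw lw'
  have h3 := hT _ _ _ (by simp; omega) wy e2.symm e3
  obtain ⟨v, e5, e6⟩ := h3.exists_of_two hT hC (by omega) f2.tail f3.tail hac hac2
  have g1 : TEq A x (c :: b :: v) := by
    refine hT _ _ _ hx f1 e1 ?_
    have k1 : TEq A (b :: w) (b :: c :: v) := .cons b e5
    exact hT _ _ _ (by simp; omega) (hC _ _ (by simp; omega) f1 k1) k1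
      (TEq.comm hbc hbc2 b.2 c.2 v)
  have g2 : TEq A x' (a :: b :: v) := by
    refine hT _ _ _ (by omega) f4 e4 ?_
    have k1 : TEq A (b :: w') (b :: a :: v) := .cons b e6
    exact hT _ _ _ (by simp; omega) (hC _ _ (by simp; omega) f4 k1) k1
      (TEq.comm hab hab2 a.2 b.2 v).symm
  exact TEq.tau (D := [(false, c.2)]) (D' := [(true, a.2)]) hac hac2
    (tauPair_two a.2 c.2) g1 g2

theorem TEq.trans_succ (hsuff : ∀ s t u : S, s ≠ t → s ≠ u → t ≠ u →
      A.m s t = 2 → A.m s u ≠ 2 → A.m s u ≠ ⊤ → A.m t u = ⊤)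
    (hT : TransUpTo A n) (hC : ClosUpTo A n) : TransUpTo A (n + 1) := by
  intro u v w hu wv h h'
  have hC' := Red.of_teq_succ hT hC
  have wu := hC' _ _ (h.length_eq ▸ hu) wv h.symm
  have ww := hC' _ _ (h.length_eq ▸ hu) wv h'
  match u, v, w with
  | [], [], w => exact h'
  | [], b :: y, _ => simpa using h.length_eq
  | a :: x, [], _ => simpa using h.length_eq
  | a :: x, b :: y, [] => simpa using h'.length_eq
  | a :: x, b :: y, c :: x' =>
    have hx : x.length ≤ n := by simpa using hu
    have l1 := h.length_eq
    have l2 := h'.length_eq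
    simp only [List.length_cons] at l1 l2
    by_cases hab : a.1 = b.1
    · obtain ⟨rfl, h0⟩ := h.of_cons hab
      rcases h'.cons_cases with ⟨rfl, h1⟩ | ⟨hne, M, D, D', z, hM, hp, h1, h1'⟩
      · exact .cons _ (hT _ _ _ hx wv.tail h0 h1)
      · exact .tau hne hM hp (hT _ _ _ hx wv.tail h0 h1) h1'
    by_cases hbc : b.1 = c.1
    · obtain ⟨rfl, h0⟩ := h'.of_cons hbc
      rcases h.cons_cases with ⟨rfl, h1⟩ | ⟨hne, M, D, D', z, hM, hp, h1, h1'⟩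
      · exact absurd rfl hab
      · exact .tau hne hM hp h1 (hT _ _ _ (by omega) wv.tail h0.symm h1')
    by_cases hac : a.1 = c.1
    · exact TEq.trans_of_fst_eq hT hC hx hab hac wu wv ww h h'.symm
    by_cases h2 : A.m b.1 a.1 = 2 ∧ A.m b.1 c.1 = 2 ∧ A.m a.1 c.1 = 2
    · exact TEq.trans_of_two hT hC hx hab hbc hac (A.symm a.1 b.1 ▸ h2.1) h2.2.1 h2.2.2
        wu.tail wv.tail ww.tail h h'
    · exfalso
      rcases h.symm.cons_cases with ⟨rfl, -⟩ | ⟨-, M, D, D', z, hM, hp, h1, -⟩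
      · exact hab rfl
      rcases h'.cons_cases with ⟨rfl, -⟩ | ⟨-, M', F, F', z', hM', hp', h3, -⟩
      · exact hbc rfl
      obtain ⟨k, ⟨f, e⟩, w, rfl, hb'⟩ :=
        geo_first_switch (A.two_le_nat hbc hM') hp'.left hp'.right hp'.beq (by simp)
      obtain rfl : f = false := hb'
      refine Red.no_triangle hsuff hT hC (Ne.symm hab) hbc hac h2 (by omega) wv.tail hM hp h1
        (l := k) (c := e) (z' := emb b.1 c.1 w ++ z') (hM' ▸ ENat.natCast_ne_top _) ?_
      convert h3 using 1
      simp [embLetter]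

theorem transUpTo_and_closUpTo (hsuff : ∀ s t u : S, s ≠ t → s ≠ u → t ≠ u →
      A.m s t = 2 → A.m s u ≠ 2 → A.m s u ≠ ⊤ → A.m t u = ⊤) (n : ℕ) :
    TransUpTo A n ∧ ClosUpTo A n := by
  induction n with
  | zero =>
    constructor
    · intro u v w hu _ h h'
      have := h.length_eq
      obtain rfl : u = [] := List.length_eq_zero_iff.1 (by omega)
      obtain rfl : v = [] := List.length_eq_zero_iff.1 (by simpa using this.symm)
      exact h'
    · intro u v hu wu h
      have := h.length_eq
      obtain rfl : v = [] := List.length_eq_zero_iff.1 (by omega)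
      exact .nil
  | succ n ih => exact ⟨TEq.trans_succ hsuff ih.1 ih.2, Red.of_teq_succ ih.1 ih.2⟩

end

section

variable {A : ArtinData S}

/-! ### The action on classes of reduced words -/

/-- Transitivity and closure for all reduced words. -/
structure Coherent (A : ArtinData S) : Prop where
  trans : ∀ n, TransUpTo A n
  clos : ∀ n, ClosUpTo A n

theorem Coherent.teq_trans (hA : Coherent A) {u v w : Word S} (wv : Red A v) (h : TEq A u v)
    (h' : TEq A v w) : TEq A u w := hA.trans _ u v w le_rfl wv h h'

theorem Coherent.red (hA : Coherent A) {u v : Word S} (wu : Red A u) (h : TEq A u v) : Red A v :=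
  hA.clos _ u v le_rfl wu h

theorem Coherent.red_cons (hA : Coherent A) {a : S × Bool} {x y : Word S} (h : Red A (a :: x))
    (hxy : TEq A x y) : Red A (a :: y) :=
  h.cons_of_teq (hA.trans x.length) (hA.clos _) le_rfl hxy

/-- Equality of reduced words. -/
def Coherent.setoid (hA : Coherent A) : Setoid {u : Word S // Red A u} where
  r u v := TEq A u.1 v.1
  iseqv := ⟨fun u => .refl u.1, fun h => h.symm, fun {_ v _} h h' => hA.teq_trans v.2 h h'⟩

/-- Classes of reduced words. -/
def Coherent.Classes (hA : Coherent A) : Type _ := Quotient hA.setoid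

/-- The class of a reduced word. -/
def Coherent.cls (hA : Coherent A) (u : Word S) (hu : Red A u) : hA.Classes :=
  Quotient.mk hA.setoid ⟨u, hu⟩

theorem Coherent.cls_eq_iff (hA : Coherent A) {u v : Word S} (hu : Red A u) (hv : Red A v) :
    hA.cls u hu = hA.cls v hv ↔ TEq A u v := by
  let := hA.setoid
  exact Quotient.eq (r := hA.setoid)

theorem Coherent.exists_cls (hA : Coherent A) (q : hA.Classes) : ∃ u hu, q = hA.cls u hu := by
  obtain ⟨⟨u, hu⟩, rfl⟩ := Quotient.exists_rep q
  exact ⟨u, hu, rfl⟩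

/-- `c` is the product of the letter `a` and the class of `u`. -/
def Coherent.IsMul (hA : Coherent A) (a : S × Bool) (u : Word S) (c : hA.Classes) : Prop :=
  (∃ h : Red A (a :: u), c = hA.cls _ h) ∨
    ∃ y, ∃ hy : Red A y, TEq A u ((a.1, !a.2) :: y) ∧ c = hA.cls y hy

theorem Coherent.exists_isMul (hA : Coherent A) (a : S × Bool) {u : Word S} (hu : Red A u) :
    ∃ c, hA.IsMul a u c := by
  by_cases h : Red A (a :: u)
  · exact ⟨_, .inl ⟨h, rfl⟩⟩
  · obtain ⟨y, hy⟩ := hu.exists_of_not_cons h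
    exact ⟨_, .inr ⟨y, (hA.red hu hy).tail, hy, rfl⟩⟩

theorem Coherent.IsMul.unique {hA : Coherent A} {a : S × Bool} {u v : Word S} {c d : hA.Classes}
    (hu : Red A u) (huv : TEq A u v) (h : hA.IsMul a u c) (h' : hA.IsMul a v d) : c = d := by
  rcases h with ⟨h, rfl⟩ | ⟨y, hy, e, rfl⟩ <;> rcases h' with ⟨h', rfl⟩ | ⟨y', hy', e', rfl⟩
  · exact (hA.cls_eq_iff _ _).2 (huv.cons a)
  · exact absurd e' ((hA.red_cons h huv).not_teq _)
  · exact absurd (hA.teq_trans hu huv.symm e) (h'.not_teq _)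
  · have := hA.teq_trans hu e.symm (hA.teq_trans (hA.red hu huv) huv e')
    exact (hA.cls_eq_iff _ _).2 (this.of_cons rfl).2

/-- Left multiplication of a class by a letter. -/
noncomputable def Coherent.lmul (hA : Coherent A) (a : S × Bool) : hA.Classes → hA.Classes :=
  Quotient.lift (fun u : {u : Word S // Red A u} => (hA.exists_isMul a u.2).choose) fun u v h =>
    Coherent.IsMul.unique u.2 h (hA.exists_isMul a u.2).choose_spec
      (hA.exists_isMul a v.2).choose_spec

theorem Coherent.IsMul.lmul_eq {hA : Coherent A} {a : S × Bool} {u : Word S} {c : hA.Classes}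
    (hu : Red A u) (h : hA.IsMul a u c) : hA.lmul a (hA.cls u hu) = c :=
  Coherent.IsMul.unique hu (.refl u) (hA.exists_isMul a hu).choose_spec h

theorem Coherent.lmul_of_red (hA : Coherent A) {a : S × Bool} {u : Word S} (h : Red A (a :: u)) :
    hA.lmul a (hA.cls u h.tail) = hA.cls (a :: u) h :=
  IsMul.lmul_eq _ (.inl ⟨h, rfl⟩)

theorem Coherent.lmul_of_teq (hA : Coherent A) {a : S × Bool} {u y : Word S} (hu : Red A u)
    (hy : Red A y) (h : TEq A u ((a.1, !a.2) :: y)) :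
    hA.lmul a (hA.cls u hu) = hA.cls y hy :=
  IsMul.lmul_eq _ (.inr ⟨y, hy, h, rfl⟩)

theorem Coherent.lmul_inv_lmul (hA : Coherent A) (a : S × Bool) (c : hA.Classes) :
    hA.lmul (a.1, !a.2) (hA.lmul a c) = c := by
  obtain ⟨u, hu, rfl⟩ := hA.exists_cls c
  by_cases h : Red A (a :: u)
  · rw [hA.lmul_of_red h]
    refine hA.lmul_of_teq h hu ?_
    simpa using TEq.refl (A := A) (a :: u)
  · obtain ⟨y, hy⟩ := hu.exists_of_not_cons h
    have wy := hA.red hu hy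
    rw [hA.lmul_of_teq hu wy.tail hy, hA.lmul_of_red wy]
    exact (hA.cls_eq_iff _ _).2 hy.symm

/-- The permutation of the classes given by a generator. -/
noncomputable def Coherent.perm (hA : Coherent A) (s : S) : Equiv.Perm hA.Classes where
  toFun := hA.lmul (s, true)
  invFun := hA.lmul (s, false)
  left_inv c := hA.lmul_inv_lmul (s, true) c
  right_inv c := hA.lmul_inv_lmul (s, false) c

/-- Left multiplication of a class by a word. -/
noncomputable def Coherent.lmulWord (hA : Coherent A) (w : Word S) (c : hA.Classes) :
    hA.Classes := w.foldr hA.lmul c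

theorem Coherent.lift_perm (hA : Coherent A) (w : Word S) (c : hA.Classes) :
    FreeGroup.lift hA.perm (FreeGroup.mk w) c = hA.lmulWord w c := by
  rw [FreeGroup.lift_mk]
  induction w with
  | nil => rfl
  | cons a w ih =>
    obtain ⟨s, b⟩ := a
    simp only [List.map_cons, List.prod_cons, Equiv.Perm.mul_apply, ih]
    cases b <;> rfl

theorem Coherent.lmulWord_of_red (hA : Coherent A) {w : Word S} (hw : Red A w) :
    hA.lmulWord w (hA.cls [] .nil) = hA.cls w hw := by
  induction w with
  | nil => rfl
  | cons a w ih =>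
    rw [← hA.lmul_of_red hw, ← ih hw.tail]
    rfl

/-! ### The braid relations hold for the action -/

theorem Coherent.exists_emb (hA : Coherent A) {s t : S} {x : Word S} (wx : Red A x) :
    ∃ (d : List Letter) (z : Word S), TEq A x (emb s t d ++ z) ∧
      ∀ l y, ¬ TEq A z (embLetter s t l :: y) := by
  induction hk : x.length using Nat.strong_induction_on generalizing x with
  | _ k ih =>
  by_cases h : ∃ l y, TEq A x (embLetter s t l :: y)
  · obtain ⟨l, y, h⟩ := h
    have ly := h.length_eq
    rw [List.length_cons] at ly
    have wy := (hA.red wx h).tail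
    obtain ⟨d, z, hd, hz⟩ := ih y.length (by omega) wy rfl
    exact ⟨l :: d, z, hA.teq_trans (hA.red wx h) h (hd.cons _), hz⟩
  · push Not at h
    exact ⟨[], x, .refl x, h⟩

theorem Coherent.red_emb (hA : Coherent A) {s t : S} {M : ℕ} (hst : s ≠ t) (hM : A.m s t = M)
    {z : Word S} (wz : Red A z) (hz : ∀ l y, ¬ TEq A z (embLetter s t l :: y)) {d : List Letter}
    (hd : Geo M d) : Red A (emb s t d ++ z) := by
  have h2 := A.two_le_nat hst hM
  induction d with
  | nil => exact wz
  | cons γ d ih =>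
    have wd := ih hd.tail
    refine .cons wd fun k hk => ?_
    have wk : Red A (emb s t [(γ.1, !γ.2)] ++ k) := hA.red wd hk
    obtain ⟨I, J, q, hzI, hk', e⟩ :=
      TEq.merge (hA.trans (d.length + z.length)) (hA.clos _) hst hM (by omega) wd wk hk
    cases I with
    | cons l I => exact hz _ _ hzI
    | nil =>
      have l1 : d.length + z.length = k.length + 1 := by simpa using hk.length_eq
      have l2 : z.length = q.length := by simpa using hzI.length_eq
      have l3 : k.length = J.length + q.length := by simpa using hk'.length_eq
      rw [List.append_nil] at e
      have := hd _ ((e.cons γ).trans (beq_cancel h2 γ J)).symm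
      simp only [List.length_cons] at this
      omega

theorem Coherent.lmul_emb (hA : Coherent A) {s t : S} {M : ℕ} (hst : s ≠ t) (hM : A.m s t = M)
    {z : Word S} (wz : Red A z) (hz : ∀ l y, ¬ TEq A z (embLetter s t l :: y))
    {γ : Letter} {e e' : List Letter} (he : Geo M e) (he' : Geo M e')
    (h : Dihedral.BEq M e' (γ :: e)) :
    hA.lmul (embLetter s t γ) (hA.cls _ (hA.red_emb hst hM wz hz he)) =
      hA.cls _ (hA.red_emb hst hM wz hz he') := by
  have h2 := A.two_le_nat hst hM
  by_cases hg : Geo M (γ :: e)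
  · refine (hA.lmul_of_red (hA.red_emb hst hM wz hz hg)).trans ((hA.cls_eq_iff _ _).2 ?_)
    exact TEq.of_beq hst hM hg he' h.symm z
  · obtain ⟨k, hk, hgk⟩ := he.exists_of_not_cons h2 hg
    refine (hA.lmul_of_teq _ (hA.red_emb hst hM wz hz hgk.tail)
      (TEq.of_beq hst hM he hgk hk z)).trans ((hA.cls_eq_iff _ _).2 ?_)
    refine TEq.of_beq hst hM hgk.tail he' ?_ z
    exact (h.trans ((hk.cons γ).trans (beq_cancel h2 γ k))).symm

theorem Coherent.lmulWord_emb (hA : Coherent A) {s t : S} {M : ℕ} (hst : s ≠ t)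
    (hM : A.m s t = M) {z : Word S} (wz : Red A z)
    (hz : ∀ l y, ¬ TEq A z (embLetter s t l :: y)) (u : List Letter) {d e : List Letter}
    (hd : Geo M d) (he : Geo M e) (h : Dihedral.BEq M e (u ++ d)) :
    hA.lmulWord (emb s t u) (hA.cls _ (hA.red_emb hst hM wz hz hd)) =
      hA.cls _ (hA.red_emb hst hM wz hz he) := by
  induction u generalizing e with
  | nil => exact (hA.cls_eq_iff _ _).2 (TEq.of_beq hst hM hd he h.symm z)
  | cons γ u ih =>
    obtain ⟨e₀, hg, h0⟩ := exists_geo M (u ++ d)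
    change hA.lmul _ (hA.lmulWord (emb s t u) _) = _
    rw [ih hg h0]
    exact hA.lmul_emb hst hM wz hz hg he (h.trans (h0.cons γ).symm)

theorem Coherent.lmulWord_congr (hA : Coherent A) {s t : S} {M : ℕ} (hst : s ≠ t)
    (hM : A.m s t = M) {u v : List Letter} (h : Dihedral.BEq M u v) (c : hA.Classes) :
    hA.lmulWord (emb s t u) c = hA.lmulWord (emb s t v) c := by
  obtain ⟨x, wx, rfl⟩ := hA.exists_cls c
  obtain ⟨d, z, hx, hz⟩ := hA.exists_emb (s := s) (t := t) wx
  have wd := hA.red wx hx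
  have hd := wd.geo hst hM
  obtain ⟨e, he, h0⟩ := exists_geo M (u ++ d)
  rw [(hA.cls_eq_iff wx wd).2 hx, hA.lmulWord_emb hst hM wd.of_append hz u hd he h0]
  exact (hA.lmulWord_emb hst hM wd.of_append hz v hd he
    (h0.trans (h.append (A.two_le_nat hst hM) (Dihedral.BEq.refl M d)))).symm

theorem emb_alt (s t : S) (k : ℕ) :
    emb s t (alt true true k) = altWord s t k ∧ emb s t (alt false true k) = altWord t s k := by
  induction k with
  | zero => exact ⟨rfl, rfl⟩
  | succ k ih =>
    simp only [alt_succ, emb_cons, Bool.not_true, Bool.not_false, ih, altWord, embLetter_true,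
      embLetter_false, and_self]

/-- A reduced word which represents the identity is empty. -/
theorem Coherent.eq_nil_of_wbar (hA : Coherent A) {w : Word S} (hw : Red A w)
    (h : wbar A w = 1) : w = [] := by
  have hrel : ∀ r ∈ rels A, FreeGroup.lift hA.perm r = 1 := by
    rintro r ⟨u, v, ⟨s, t, k, hst, hk, rfl, rfl⟩, rfl⟩
    rw [map_mul, map_inv, mul_inv_eq_one]
    ext c
    rw [hA.lift_perm, hA.lift_perm, ← (emb_alt s t k).1, ← (emb_alt s t k).2]
    exact hA.lmulWord_congr hst hk (beq_alt (A.two_le_nat hst hk) _ _) c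
  have h1 : PresentedGroup.toGroup hrel (wbar A w) = FreeGroup.lift hA.perm (FreeGroup.mk w) := rfl
  rw [h, map_one] at h1
  have h2 := hA.lift_perm w (hA.cls [] .nil)
  rw [← h1, hA.lmulWord_of_red hw] at h2
  have h3 := (hA.cls_eq_iff _ _).1 h2
  exact List.length_eq_zero_iff.1 h3.length_eq.symm

end

section

variable {A : ArtinData S}

/-! ### Special transformations -/

theorem Step0.append {x y : Word S} (h : Step0 x y) (l r : Word S) :
    Step0 (l ++ x ++ r) (l ++ y ++ r) := by
  obtain ⟨w₁, w₂, s, b, rfl, rfl⟩ := h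
  exact ⟨l ++ w₁, w₂ ++ r, s, b, by simp, by simp⟩

theorem Step1.append {x y : Word S} (h : Step1 A x y) (l r : Word S) :
    Step1 A (l ++ x ++ r) (l ++ y ++ r) := by
  obtain ⟨w₁, w₂, u, v, hr, h⟩ := h
  refine ⟨l ++ w₁, w₂ ++ r, u, v, hr, ?_⟩
  rcases h with ⟨rfl, rfl⟩ | ⟨rfl, rfl⟩
  · left; simp
  · right; simp

theorem Step2.append {x y : Word S} (h : Step2 A x y) (l r : Word S) :
    Step2 A (l ++ x ++ r) (l ++ y ++ r) := by
  rcases h with ⟨w₁, w₂, u₁, u₂, v₁, v₂, hr, h1, h2, rfl, rfl⟩ |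
    ⟨w₁, w₂, u₁, u₂, v₁, v₂, hr, h1, h2, rfl, rfl⟩
  · exact .inl ⟨l ++ w₁, w₂ ++ r, u₁, u₂, v₁, v₂, hr, h1, h2, by simp, by simp⟩
  · exact .inr ⟨l ++ w₁, w₂ ++ r, u₁, u₂, v₁, v₂, hr, h1, h2, by simp, by simp⟩

theorem Steps012.append {x y : Word S} (h : Steps012 A x y) (l r : Word S) :
    Steps012 A (l ++ x ++ r) (l ++ y ++ r) := by
  induction h with
  | refl => exact .refl
  | tail _ hs ih =>
    refine ih.tail ?_
    rcases hs with hs | hs | hs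
    · exact .inl (hs.append l r)
    · exact .inr (.inl (hs.append l r))
    · exact .inr (.inr (hs.append l r))

theorem Steps012.cons {x y : Word S} (a : S × Bool) (h : Steps012 A x y) :
    Steps012 A (a :: x) (a :: y) := by
  simpa using h.append [a] []

theorem Steps012.append_right {x y : Word S} (h : Steps012 A x y) (r : Word S) :
    Steps012 A (x ++ r) (y ++ r) := by
  simpa using h.append [] r

theorem Steps012.cancel (a : S × Bool) (x : Word S) : Steps012 A (a :: (a.1, !a.2) :: x) x :=
  .single (.inl ⟨[], x, a.1, a.2, by simp, rfl⟩)

theorem wordInv_append (u v : Word S) : wordInv (u ++ v) = wordInv v ++ wordInv u := by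
  simp [wordInv]

theorem alt_succ' (f b : Bool) (n : ℕ) : alt f b (n + 1) = alt f b n ++ [(f ^^ n.bodd, b)] := by
  rw [alt_add]; rfl

theorem emb_alt_false (s t : S) (f : Bool) (n : ℕ) :
    emb s t (alt f false n) = wordInv (emb s t (alt (f ^^ (n + 1).bodd) true n)) := by
  induction n generalizing f with
  | zero => rfl
  | succ n ih =>
    rw [alt_succ, alt_succ', emb_append, wordInv_append, emb_cons, ih]
    have e1 : ((!f) ^^ (n + 1).bodd) = (f ^^ (n + 1 + 1).bodd) := by
      cases f <;> cases h : n.bodd <;> simp [h]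
    have e2 : ((f ^^ (n + 1 + 1).bodd) ^^ n.bodd) = f := by
      cases f <;> cases h : n.bodd <;> simp [h]
    rw [e1, e2]
    rfl

theorem isRel_emb {s t : S} {M : ℕ} (hst : s ≠ t) (hM : A.m s t = M) (f : Bool) :
    IsRel A (emb s t (alt f true M)) (emb s t (alt (!f) true M)) := by
  obtain ⟨h1, h2⟩ := emb_alt s t M
  cases f
  · exact ⟨t, s, M, hst.symm, (A.symm t s).trans hM, h2, h1⟩
  · exact ⟨s, t, M, hst, hM, h1, h2⟩

theorem emb_alt_ne_nil {s t : S} {f b : Bool} {n : ℕ} (hn : 1 ≤ n) : emb s t (alt f b n) ≠ [] := by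
  intro h
  have := congrArg List.length h
  simp at this
  omega

/-- Each length-preserving dihedral move is a sequence of special transformations, in both
directions. -/
theorem Dihedral.Conn.steps {s t : S} {M : ℕ} (hst : s ≠ t) (hM : A.m s t = M)
    {u v : List Letter} (h : Conn M u v) :
    Steps012 A (emb s t u) (emb s t v) ∧ Steps012 A (emb s t v) (emb s t u) := by
  induction h with
  | refl u => exact ⟨.refl, .refl⟩
  | symm _ ih => exact ih.symm
  | trans _ _ ih1 ih2 => exact ⟨ih1.1.trans ih2.1, ih2.2.trans ih1.2⟩
  | cons l _ ih => exact ⟨ih.1.cons _, ih.2.cons _⟩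
  | full f b w =>
    have key : ∀ f, Step1 A (emb s t (alt f b M ++ w)) (emb s t (alt (!f) b M ++ w)) := by
      intro f
      cases b
      · refine ⟨[], emb s t w, _, _, isRel_emb hst hM (f ^^ M.bodd), .inr ?_⟩
        rw [emb_append, emb_append, emb_alt_false, emb_alt_false]
        have e1 : (f ^^ (M + 1).bodd) = !(f ^^ M.bodd) := by
          cases f <;> cases h : M.bodd <;> simp [h]
        have e2 : ((!f) ^^ (M + 1).bodd) = (f ^^ M.bodd) := by
          cases f <;> cases h : M.bodd <;> simp [h]
        rw [e1, e2]
        simp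
      · refine ⟨[], emb s t w, _, _, isRel_emb hst hM (!f), .inl ?_⟩
        simp
    refine ⟨.single (.inr (.inl (key f))), .single (.inr (.inl ?_))⟩
    simpa using key (!f)
  | swap g a c w ha haM hc hcM =>
    have hrel := isRel_emb hst hM (!g)
    obtain ⟨d, rfl⟩ : ∃ d, M = a + d := ⟨M - a, by omega⟩
    have e : alt (!g) true (a + d) =
        alt (!g) true c ++ alt ((!g) ^^ c.bodd) true (a + d - c) := by
      rw [← alt_add]; congr 1; omega
    rw [e, alt_add, Bool.not_not, emb_append, emb_append] at hrel
    have k1 : emb s t (alt (g ^^ (a + 1).bodd) false a) = wordInv (emb s t (alt g true a)) := by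
      rw [emb_alt_false]
      congr 3
      cases g <;> cases h : a.bodd <;> simp [h]
    have k2 : emb s t (alt (g ^^ (a + d).bodd) false (a + d - c)) =
        wordInv (emb s t (alt ((!g) ^^ c.bodd) true (a + d - c))) := by
      rw [emb_alt_false]
      congr 3
      have : (a + d).bodd = ((a + d - c).bodd ^^ c.bodd) := by
        rw [← Nat.bodd_add]; congr 1; omega
      rw [this]
      cases g <;> cases h : c.bodd <;> cases h' : (a + d - c).bodd <;> simp [h']
    have k3 : a + d - a = d := by omega
    rw [k3]
    simp only [emb_append, k1, k2]
    constructor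
    · refine .single (.inr (.inr (.inl ⟨[], emb s t w, _, _, _, _, hrel, emb_alt_ne_nil hc,
        emb_alt_ne_nil ha, ?_, ?_⟩))) <;> simp
    · refine .single (.inr (.inr (.inr ⟨[], emb s t w, _, _, _, _, hrel,
        emb_alt_ne_nil (by omega), emb_alt_ne_nil (by omega), ?_, ?_⟩))) <;> simp

theorem TEq.steps {u v : Word S} (h : TEq A u v) : Steps012 A u v ∧ Steps012 A v u := by
  induction h with
  | nil => exact ⟨.refl, .refl⟩
  | cons a _ ih => exact ⟨ih.1.cons a, ih.2.cons a⟩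
  | @tau s t M p q D D' x y z hst hM hp _ _ ih1 ih2 =>
    have h := (hp.left.conn (A.two_le_nat hst hM) hp.right hp.beq).steps hst hM
    have h1 : Steps012 A ((s, p) :: (emb s t D ++ z)) ((t, q) :: (emb s t D' ++ z)) :=
      h.1.append_right z
    have h2 : Steps012 A ((t, q) :: (emb s t D' ++ z)) ((s, p) :: (emb s t D ++ z)) :=
      h.2.append_right z
    exact ⟨(ih1.1.cons _).trans (h1.trans (ih2.2.cons _)),
      (ih2.1.cons _).trans (h2.trans (ih1.2.cons _))⟩

theorem Coherent.exists_red (hA : Coherent A) (w : Word S) :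
    ∃ v, Steps012 A w v ∧ Red A v := by
  induction w with
  | nil => exact ⟨[], .refl, .nil⟩
  | cons a w ih =>
    obtain ⟨v, hs, hv⟩ := ih
    by_cases h : Red A (a :: v)
    · exact ⟨_, hs.cons a, h⟩
    · obtain ⟨y, hy⟩ := hv.exists_of_not_cons h
      exact ⟨y, (hs.cons a).trans ((hy.steps.1.cons a).trans (Steps012.cancel a y)), (hA.red hv hy).tail⟩

theorem mk_wordInv (w : Word S) : FreeGroup.mk (wordInv w) = (FreeGroup.mk w)⁻¹ := by
  rw [FreeGroup.inv_mk]
  congr 1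
  simp [wordInv, FreeGroup.invRev]

theorem wbar_append (u v : Word S) : wbar A (u ++ v) = wbar A u * wbar A v := by
  rw [wbar, ← FreeGroup.mul_mk, map_mul]; rfl

theorem wbar_wordInv (u : Word S) : wbar A (wordInv u) = (wbar A u)⁻¹ := by
  rw [wbar, mk_wordInv, map_inv]; rfl

theorem IsRel.wbar_eq {u v : Word S} (h : IsRel A u v) : wbar A u = wbar A v := by
  have : PresentedGroup.mk (rels A) (FreeGroup.mk u * (FreeGroup.mk v)⁻¹) = 1 :=
    PresentedGroup.one_of_mem ⟨u, v, h, rfl⟩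
  rw [map_mul, map_inv, mul_inv_eq_one] at this
  exact this

theorem Steps012.wbar_eq {u v : Word S} (h : Steps012 A u v) : wbar A u = wbar A v := by
  induction h with
  | refl => rfl
  | tail _ hs ih =>
    rw [ih]
    rcases hs with ⟨w₁, w₂, s, b, rfl, rfl⟩ | ⟨w₁, w₂, u, v, hr, ⟨rfl, rfl⟩ | ⟨rfl, rfl⟩⟩ |
      ⟨w₁, w₂, u₁, u₂, v₁, v₂, hr, -, -, rfl, rfl⟩ | ⟨w₁, w₂, u₁, u₂, v₁, v₂, hr, -, -, rfl, rfl⟩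
    · have : wbar A [(s, b), (s, !b)] = 1 := by
        have e : ([(s, b), (s, !b)] : Word S) = [(s, b)] ++ wordInv [(s, b)] := rfl
        rw [e, wbar_append, wbar_wordInv, mul_inv_cancel]
      simp only [wbar_append, this, mul_one]
    · simp only [wbar_append, hr.wbar_eq]
    · simp only [wbar_append, wbar_wordInv, hr.wbar_eq]
    all_goals
      have h := hr.wbar_eq
      simp only [wbar_append] at h
      have : (wbar A v₁)⁻¹ * wbar A u₁ = wbar A v₂ * (wbar A u₂)⁻¹ := by
        rw [inv_mul_eq_iff_eq_mul, ← mul_assoc, ← h, mul_inv_cancel_right]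
      simp only [wbar_append, wbar_wordInv]
      simp only [mul_assoc (wbar A w₁), this]

end

end

/-- Theorem 1: For every Artin–Tits presentation of sufficiently large type
and every word `w` over `S ∪ S⁻¹`: `w →_{0,1,2} ε` if and only if `w̄ = 1`. -/
theorem stmt0 {S : Type*} [Finite S] (A : ArtinData S)
    (hsuff : ∀ s t u : S, s ≠ t → s ≠ u → t ≠ u →
      A.m s t = 2 → A.m s u ≠ 2 → A.m s u ≠ ⊤ → A.m t u = ⊤)
    (w : Word S) :
    Steps012 A w [] ↔ wbar A w = 1 := by
  constructor
  · intro h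
    rw [h.wbar_eq]
    rfl
  · intro h
    have hA : Coherent A := ⟨fun n => (transUpTo_and_closUpTo hsuff n).1,
      fun n => (transUpTo_and_closUpTo hsuff n).2⟩
    obtain ⟨v, hs, hv⟩ := hA.exists_red w
    have hnil := hA.eq_nil_of_wbar hv (hs.wbar_eq ▸ h)
    subst hnil
    exact hs

end ArtinTits
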